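/- arXiv:math/0403405 — 11 statements merged into one kernel-verified Lean document; each statement's English description precedes it below -/
import Mathlib

section
/- Let m ≥ 1 and let ℰ be a continuous symmetric m-multilinear form on C(S¹,ℂ), and set E(y) = ℰ(y,…,y). Then E is additive, i.e. E(x+y) = E(x) + E(y) whenever supp x ∩ supp y = ∅, if and only if ℰ(y₁,…,y_m) = 0 for all y₁,…,y_m ∈ C(S¹,ℂ) with ⋂_{j=1}^m supp y_j = ∅. -/
open MeasureTheory

/-- An alternating sum over all finsets vanishes if the summand does not depend on whether a fixed
element belongs to the finset. -/
theorem sum_neg_one_pow_card_mul_eq_zero {ι R : Type*} [Fintype ι] [DecidableEq ι] [CommRing R]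
    (a : ι) (h : Finset ι → R) (hh : ∀ S, h (insert a S) = h S) :
    ∑ S : Finset ι, (-1) ^ S.card * h S = 0 := by
  refine Finset.sum_involution (fun S _ => if a ∈ S then S.erase a else insert a S) ?_ ?_ ?_ ?_
  · intro S _
    by_cases haS : a ∈ S
    · have h1 : h (S.erase a) = h S := by rw [← hh (S.erase a), Finset.insert_erase haS]
      rw [if_pos haS, h1, ← Finset.card_erase_add_one haS, pow_succ]
      ring
    · rw [if_neg haS, hh, Finset.card_insert_of_notMem haS, pow_succ]
      ring
  · intro S _ _ hS
    by_cases haS : a ∈ S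
    · rw [if_pos haS] at hS
      exact Finset.notMem_erase a S (hS.symm ▸ haS)
    · rw [if_neg haS] at hS
      exact haS (hS ▸ Finset.mem_insert_self a S)
  · intro S _
    exact Finset.mem_univ _
  · intro S _
    by_cases haS : a ∈ S
    · simp [haS]
    · simp [haS]

/-- The polarization identity for symmetric multilinear forms. -/
theorem MultilinearMap.polarization {ι R M : Type*} [Fintype ι] [DecidableEq ι] [CommRing R]
    [AddCommGroup M] [Module R M] (f : MultilinearMap R (fun _ : ι => M) R)
    (hf : ∀ (σ : Equiv.Perm ι) (u : ι → M), f (fun j => u (σ j)) = f u) (u : ι → M) :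
    ∑ S : Finset ι, (-1) ^ S.card * f (fun _ => ∑ i ∈ Sᶜ, u i) =
      (Fintype.card ι).factorial * f u := by
  have expand (S : Finset ι) : f (fun _ => ∑ i ∈ Sᶜ, u i) =
      ∑ r : ι → ι, if S ⊆ (Finset.univ.image r)ᶜ then f (fun j => u (r j)) else 0 := by
    rw [f.map_sum_finset (fun _ i => u i) (fun _ => Sᶜ), ← Finset.sum_filter]
    refine Finset.sum_congr ?_ fun _ _ => rfl
    ext r
    simp only [Fintype.mem_piFinset, Finset.mem_compl, Finset.mem_filter, Finset.mem_univ,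
      true_and, Finset.subset_iff, Finset.mem_image, not_exists]
    exact ⟨fun H x hx j hj => H j (hj ▸ hx), fun H j hj => H hj j rfl⟩
  have inner (r : ι → ι) : (∑ S : Finset ι, (-1 : R) ^ S.card *
      if S ⊆ (Finset.univ.image r)ᶜ then f (fun j => u (r j)) else 0) =
      if Function.Bijective r then f u else 0 := by
    simp only [mul_ite, mul_zero]
    rw [← Finset.sum_filter, ← Finset.sum_mul]
    have h1 : Finset.univ.filter (fun S : Finset ι => S ⊆ (Finset.univ.image r)ᶜ) =
        ((Finset.univ.image r)ᶜ).powerset := by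
      ext S; simp
    have h2 := congrArg (Int.cast : ℤ → R)
      (Finset.sum_powerset_neg_one_pow_card (x := (Finset.univ.image r)ᶜ))
    push_cast at h2
    rw [h1, h2]
    have h3 : (Finset.univ.image r)ᶜ = ∅ ↔ Function.Bijective r := by
      rw [Finset.compl_eq_empty_iff, ← Finite.surjective_iff_bijective, ← Finset.coe_eq_univ,
        Finset.coe_image, Finset.coe_univ, Set.image_univ, Set.range_eq_univ]
    by_cases hr : Function.Bijective r
    · rw [if_pos (h3.2 hr), if_pos hr, one_mul]
      exact hf (Equiv.ofBijective r hr) u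
    · rw [if_neg (fun h => hr (h3.1 h)), if_neg hr, zero_mul]
  simp_rw [expand, Finset.mul_sum]
  rw [Finset.sum_comm]
  simp_rw [inner]
  rw [← Finset.sum_filter, Finset.sum_const, nsmul_eq_mul, ← Fintype.card_subtype,
    Fintype.card_congr (Equiv.ofBijective (α := Equiv.Perm ι)
      (β := {r : ι → ι // Function.Bijective r}) (fun σ => ⟨σ, σ.bijective⟩)
      ⟨fun σ τ h => Equiv.ext fun x => congrFun (congrArg Subtype.val h) x,
        fun r => ⟨Equiv.ofBijective r.1 r.2, rfl⟩⟩).symm, Fintype.card_perm]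

theorem tsupport_sum_subset {X ι : Type*} [TopologicalSpace X] (F : Finset ι) (u : ι → C(X, ℂ)) :
    tsupport ⇑(∑ i ∈ F, u i) ⊆ ⋃ i ∈ F, tsupport ⇑(u i) := by
  refine closure_minimal ?_ (F.finite_toSet.isClosed_biUnion fun i _ => isClosed_tsupport _)
  intro x hx
  rw [Function.mem_support, ContinuousMap.sum_apply] at hx
  obtain ⟨i, hi, hxi⟩ := Finset.exists_ne_zero_of_sum_ne_zero hx
  exact Set.mem_biUnion hi (subset_tsupport _ hxi)

/-- A symmetric form whose diagonal is additive vanishes on families that split into two nonempty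
groups with mutually disjoint supports. -/
theorem MultilinearMap.eq_zero_of_separated {X ι : Type*} [TopologicalSpace X] [Fintype ι]
    (f : MultilinearMap ℂ (fun _ : ι => C(X, ℂ)) ℂ)
    (hf : ∀ (σ : Equiv.Perm ι) (u : ι → C(X, ℂ)), f (fun j => u (σ j)) = f u)
    (hadd : ∀ x y : C(X, ℂ), tsupport ⇑x ∩ tsupport ⇑y = ∅ →
      f (fun _ => x + y) = f (fun _ => x) + f (fun _ => y))
    (u : ι → C(X, ℂ)) (P : ι → Prop) {a b : ι} (ha : P a) (hb : ¬ P b)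
    (hsep : ∀ i j, P i → ¬ P j → tsupport ⇑(u i) ∩ tsupport ⇑(u j) = ∅) : f u = 0 := by
  classical
  have split (S : Finset ι) : f (fun _ => ∑ i ∈ Sᶜ, u i) =
      f (fun _ => ∑ i ∈ Sᶜ with P i, u i) + f (fun _ => ∑ i ∈ Sᶜ with ¬ P i, u i) := by
    rw [← hadd, Finset.sum_filter_add_sum_filter_not]
    refine Set.eq_empty_iff_forall_notMem.2 fun x ⟨h1, h2⟩ => ?_
    obtain ⟨i, hi, hxi⟩ := Set.mem_iUnion₂.1 (tsupport_sum_subset _ _ h1)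
    obtain ⟨j, hj, hxj⟩ := Set.mem_iUnion₂.1 (tsupport_sum_subset _ _ h2)
    have := hsep i j (Finset.mem_filter.1 hi).2 (Finset.mem_filter.1 hj).2
    exact this.subset ⟨hxi, hxj⟩
  have key := f.polarization hf u
  simp_rw [split, mul_add] at key
  rw [Finset.sum_add_distrib,
    sum_neg_one_pow_card_mul_eq_zero b (fun S => f (fun _ => ∑ i ∈ Sᶜ with P i, u i)),
    sum_neg_one_pow_card_mul_eq_zero a (fun S => f (fun _ => ∑ i ∈ Sᶜ with ¬ P i, u i)),
    add_zero, eq_comm, mul_eq_zero] at key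
  · exact key.resolve_left (Nat.cast_ne_zero.2 (Nat.factorial_ne_zero _))
  · intro S
    congr! 3
    ext i
    simp only [Finset.mem_filter, Finset.mem_compl, Finset.mem_insert]
    grind
  · intro S
    congr! 3
    ext i
    simp only [Finset.mem_filter, Finset.mem_compl, Finset.mem_insert]
    grind

/-- Points in sets joined by a chain of intersecting sets of small diameter are close. -/
theorem dist_le_of_walk {X V : Type*} [PseudoMetricSpace X]
    {G : SimpleGraph V} (K : V → Set X) {d : ℝ}
    (hK : ∀ v, ∀ x ∈ K v, ∀ y ∈ K v, dist x y ≤ d)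
    (hG : ∀ v w, G.Adj v w → (K v ∩ K w).Nonempty) {a b : V} (p : G.Walk a b) :
    ∀ x ∈ K a, ∀ z ∈ K b, dist x z ≤ (p.length + 1) * d := by
  induction p with
  | nil =>
    intro x hx z hz
    simpa using hK _ x hx z hz
  | cons h p ih =>
    intro x hx z hz
    obtain ⟨y, hy1, hy2⟩ := hG _ _ h
    have h1 := hK _ x hx y hy1
    have h2 := ih y hy2 z hz
    have h3 := dist_triangle x y z
    rw [SimpleGraph.Walk.length_cons]
    push_cast
    linarith

/-- A finite continuous partition of unity with supports of small diameter. -/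
theorem exists_finite_partition_dist_le {X : Type*} [MetricSpace X] [CompactSpace X] {d : ℝ}
    (hd : 0 < d) : ∃ (t : Set X) (_ : Fintype t) (φ : t → C(X, ℂ)), ∑ i, φ i = 1 ∧
      ∀ i, ∀ x ∈ tsupport ⇑(φ i), ∀ y ∈ tsupport ⇑(φ i), dist x y ≤ d := by
  obtain ⟨t, -, htf, ht⟩ := finite_cover_balls_of_compact (isCompact_univ (X := X)) (half_pos hd)
  obtain ⟨ρ, hρ⟩ := PartitionOfUnity.exists_isSubordinate isClosed_univ
    (fun i : t => Metric.ball (i : X) (d / 2)) (fun _ => Metric.isOpen_ball)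
    (by simpa [Set.iUnion_subtype] using ht)
  let _ := htf.fintype
  let φ : t → C(X, ℂ) := fun i => ⟨fun x => (ρ i x : ℂ), by fun_prop⟩
  have hsub (i : t) : tsupport ⇑(φ i) ⊆ Metric.ball (i : X) (d / 2) := by
    refine (closure_mono ?_).trans (hρ i)
    intro x hx
    simpa [φ] using hx
  refine ⟨t, inferInstance, φ, ?_, fun i x hx y hy => ?_⟩
  · ext x
    have h := ρ.sum_eq_one (Set.mem_univ x)
    rw [finsum_eq_sum_of_fintype] at h
    rw [ContinuousMap.sum_apply]
    simpa [φ] using congrArg (Complex.ofReal) h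
  · have h1 := Metric.mem_ball.1 (hsub i hx)
    have h2 := Metric.mem_ball'.1 (hsub i hy)
    linarith [dist_triangle x i y]

/-- A symmetric form with additive diagonal on `C(X, ℂ)`, for `X` compact metric, vanishes on
families whose supports have no common point. -/
theorem MultilinearMap.eq_zero_of_iInter_tsupport_eq_empty {X ι : Type*} [MetricSpace X]
    [CompactSpace X] [Fintype ι] [Nonempty ι]
    (f : MultilinearMap ℂ (fun _ : ι => C(X, ℂ)) ℂ)
    (hf : ∀ (σ : Equiv.Perm ι) (u : ι → C(X, ℂ)), f (fun j => u (σ j)) = f u)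
    (hadd : ∀ x y : C(X, ℂ), tsupport ⇑x ∩ tsupport ⇑y = ∅ →
      f (fun _ => x + y) = f (fun _ => x) + f (fun _ => y))
    (y : ι → C(X, ℂ)) (hy : (⋂ j, tsupport ⇑(y j)) = ∅) : f y = 0 := by
  classical
  obtain ⟨ε, hε, hball⟩ := lebesgue_number_lemma_of_metric (isCompact_univ (X := X))
    (c := fun j => (tsupport ⇑(y j))ᶜ) (fun j => (isClosed_tsupport _).isOpen_compl)
    (by rw [← Set.compl_iInter, hy, Set.compl_empty])
  have hcard : (0 : ℝ) < Fintype.card ι + 1 := by positivity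
  obtain ⟨t, _, φ, hφ, hdiam⟩ :=
    exists_finite_partition_dist_le (X := X) (div_pos hε hcard)
  have hyφ : y = fun j => ∑ i, φ i * y j := by
    ext1 j
    rw [← Finset.sum_mul, hφ, one_mul]
  rw [hyφ, f.map_sum]
  refine Finset.sum_eq_zero fun r _ => ?_
  set u : ι → C(X, ℂ) := fun j => φ (r j) * y j with hu
  have hu1 (j : ι) : tsupport ⇑(u j) ⊆ tsupport ⇑(φ (r j)) := by
    rw [hu, ContinuousMap.coe_mul]
    exact tsupport_mul_subset_left
  have hu2 (j : ι) : tsupport ⇑(u j) ⊆ tsupport ⇑(y j) := by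
    rw [hu, ContinuousMap.coe_mul]
    exact tsupport_mul_subset_right
  have hzero (j : ι) (hj : tsupport ⇑(u j) = ∅) : f u = 0 :=
    f.map_coord_zero j (DFunLike.coe_injective (tsupport_eq_empty_iff.1 hj))
  let G : SimpleGraph ι :=
    { Adj := fun i j => i ≠ j ∧ (tsupport ⇑(u i) ∩ tsupport ⇑(u j)).Nonempty
      symm := ⟨fun i j h => ⟨h.1.symm, Set.inter_comm _ _ ▸ h.2⟩⟩
      loopless := ⟨fun i h => h.1 rfl⟩ }
  obtain ⟨a⟩ := ‹Nonempty ι›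
  by_cases hconn : ∀ b, G.Reachable a b
  · rcases (tsupport ⇑(u a)).eq_empty_or_nonempty with ha | ⟨x, hx⟩
    · exact hzero a ha
    obtain ⟨j, hj⟩ := hball x (Set.mem_univ x)
    refine hzero j (Set.eq_empty_iff_forall_notMem.2 fun z hz => hj ?_ (hu2 j hz))
    obtain ⟨p, hp⟩ := (hconn j).exists_isPath
    have h1 := dist_le_of_walk (G := G) (fun i => tsupport ⇑(u i))
      (fun i x hx y hy => hdiam (r i) x (hu1 i hx) y (hu1 i hy)) (fun _ _ h => h.2) p x hx z hz
    have h2 : (p.length : ℝ) + 1 < Fintype.card ι + 1 := by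
      exact_mod_cast Nat.succ_lt_succ hp.length_lt
    rw [Metric.mem_ball']
    calc dist x z ≤ (p.length + 1) * (ε / (Fintype.card ι + 1)) := h1
      _ < (Fintype.card ι + 1) * (ε / (Fintype.card ι + 1)) := by gcongr
      _ = ε := mul_div_cancel₀ ε hcard.ne'
  · push Not at hconn
    obtain ⟨b, hb⟩ := hconn
    refine f.eq_zero_of_separated hf hadd u (G.Reachable a) (SimpleGraph.Reachable.refl a) hb ?_
    intro i j hi hj
    by_contra hne
    have hij : i ≠ j := fun h => hj (h ▸ hi)
    have hadj : G.Adj i j := ⟨hij, Set.nonempty_iff_ne_empty.2 hne⟩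
    exact hj (hi.trans hadj.reachable)

/-- A form that vanishes on families whose supports have no common point has additive diagonal. -/
theorem MultilinearMap.diagonal_add_of_disjoint_tsupport {X ι : Type*} [TopologicalSpace X]
    [Fintype ι] [Nonempty ι] (f : MultilinearMap ℂ (fun _ : ι => C(X, ℂ)) ℂ)
    (hvan : ∀ y : ι → C(X, ℂ), (⋂ j, tsupport ⇑(y j)) = ∅ → f y = 0)
    (x y : C(X, ℂ)) (hxy : tsupport ⇑x ∩ tsupport ⇑y = ∅) :
    f (fun _ => x + y) = f (fun _ => x) + f (fun _ => y) := by
  classical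
  have h := f.map_add_univ (fun _ => x) (fun _ => y)
  rw [Fintype.sum_eq_add Finset.univ ∅ Finset.univ_nonempty.ne_empty] at h
  · rw [Finset.piecewise_univ, Finset.piecewise_empty] at h
    exact h
  · rintro S ⟨h1, h2⟩
    refine hvan _ (Set.eq_empty_iff_forall_notMem.2 fun z hz => ?_)
    obtain ⟨i, hi⟩ := Finset.nonempty_iff_ne_empty.2 h2
    obtain ⟨j, hj⟩ : ∃ j, j ∉ S := by
      by_contra! H
      exact h1 (Finset.eq_univ_of_forall H)
    rw [Set.mem_iInter] at hz
    have hzi := hz i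
    have hzj := hz j
    rw [Finset.piecewise_eq_of_mem _ _ _ hi] at hzi
    rw [Finset.piecewise_eq_of_notMem _ _ _ hj] at hzj
    exact hxy.subset ⟨hzi, hzj⟩


/-- Lemma 1.2(a): a continuous symmetric `m`-multilinear form `ℰ` on `C(S¹, ℂ)`
gives an additive homogeneous polynomial `E(y) = ℰ(y,…,y)` iff `ℰ` vanishes on
tuples whose supports have empty intersection. -/
theorem additive_iff_vanishes_on_disjoint_supports
    (m : ℕ) (hm : 1 ≤ m)
    (ℰ : ContinuousMultilinearMap ℂ
      (fun _ : Fin m => C(AddCircle (1 : ℝ), ℂ)) ℂ)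
    (hsymm : ∀ (σ : Equiv.Perm (Fin m)) (y : Fin m → C(AddCircle (1 : ℝ), ℂ)),
      ℰ (fun j => y (σ j)) = ℰ y)
    (E : C(AddCircle (1 : ℝ), ℂ) → ℂ)
    (hE : ∀ y, E y = ℰ (fun _ => y)) :
    (∀ x y : C(AddCircle (1 : ℝ), ℂ),
        tsupport ⇑x ∩ tsupport ⇑y = ∅ → E (x + y) = E x + E y) ↔
    (∀ y : Fin m → C(AddCircle (1 : ℝ), ℂ),
        (⋂ j, tsupport ⇑(y j)) = ∅ → ℰ y = 0) := by
  have : Nonempty (Fin m) := ⟨⟨0, hm⟩⟩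
  have : Fact ((0 : ℝ) < 1) := ⟨one_pos⟩
  simp only [hE]
  exact ⟨fun hadd y hy =>
      ℰ.toMultilinearMap.eq_zero_of_iInter_tsupport_eq_empty hsymm hadd y hy,
    fun hvan x y hxy => ℰ.toMultilinearMap.diagonal_add_of_disjoint_tsupport hvan x y hxy⟩
end

section
/- Let m ≥ 2 and let ℰ be a continuous symmetric m-multilinear form on C(S¹,ℂ) such that ℰ(y₁,…,y_m) = 0 whenever y₁,…,y_m ∈ C(S¹,ℂ) satisfy ⋂_{j=1}^m supp y_j = ∅, and such that ℰ(x,…,x) = 0 for every x ∈ C(S¹,ℂ) with ∫_{S¹} x = 0. Then ℰ = 0. -/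
open MeasureTheory

/-- The defect of balancedness of a bilinear form `B` with respect to multiplication by `f`. -/
def balanceDefect {A : Type*} [CommRing A] [Algebra ℂ A] (B : A →ₗ[ℂ] A →ₗ[ℂ] ℂ) (a b : A) :
    A →ₗ[ℂ] ℂ :=
  B.flip b ∘ₗ LinearMap.mulLeft ℂ a - B a ∘ₗ LinearMap.mulRight ℂ b

section Algebra

variable {A : Type*} [CommRing A] [Algebra ℂ A] (B : A →ₗ[ℂ] A →ₗ[ℂ] ℂ)

lemma balanceDefect_apply (a b f : A) :
    balanceDefect B a b f = B (a * f) b - B a (f * b) := rfl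

lemma balanceDefect_add_left (a a' b f : A) :
    balanceDefect B (a + a') b f = balanceDefect B a b f + balanceDefect B a' b f := by
  simp only [balanceDefect_apply, add_mul, map_add, LinearMap.add_apply]
  ring

lemma balanceDefect_sum_left {ι : Type*} (s : Finset ι) (a : ι → A) (b f : A) :
    balanceDefect B (∑ i ∈ s, a i) b f = ∑ i ∈ s, balanceDefect B (a i) b f := by
  simp only [balanceDefect_apply, Finset.sum_mul, map_sum, LinearMap.sum_apply,
    Finset.sum_sub_distrib]

lemma balanceDefect_add_smul_one (a b f : A) (c : ℂ) :
    balanceDefect B a b (f + c • 1) = balanceDefect B a b f := by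
  rw [map_add, map_smul, balanceDefect_apply B a b 1]
  simp

end Algebra

lemma abs_le_pi_div_three_of_half_le_cos {t : ℝ} (ht : |t| ≤ Real.pi) (hc : 1 / 2 ≤ Real.cos t) :
    |t| ≤ Real.pi / 3 := by
  by_contra! h
  have := Real.cos_lt_cos_of_nonneg_of_le_pi (by positivity) ht h
  rw [Real.cos_abs, Real.cos_pi_div_three] at this
  linarith

/-- A continuous cutoff equal to `1` on `[-2, 2]` and to `0` off `(-3, 3)`. -/
def cutoff (t : ℝ) : ℝ := max 0 (min 1 (3 - |t|))

lemma continuous_cutoff : Continuous cutoff := by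
  unfold cutoff; fun_prop

lemma cutoff_eq_one {t : ℝ} (h : |t| ≤ 2) : cutoff t = 1 := by
  rw [cutoff, min_eq_left (by linarith), max_eq_right zero_le_one]

lemma cutoff_eq_zero {t : ℝ} (h : 3 ≤ |t|) : cutoff t = 0 := by
  rw [cutoff, min_eq_right (by linarith), max_eq_left (by linarith)]

/-- A continuous function vanishing on `(-∞, 1/2]` and equal to `1` on `[3/5, ∞)`. -/
def ramp (t : ℝ) : ℝ := max 0 (min 1 (10 * t - 5))

lemma continuous_ramp : Continuous ramp := by
  unfold ramp; fun_prop

lemma ramp_nonneg (t : ℝ) : 0 ≤ ramp t := le_max_left _ _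

lemma ramp_le_one (t : ℝ) : ramp t ≤ 1 := max_le zero_le_one (min_le_left _ _)

lemma ramp_eq_zero {t : ℝ} (h : t ≤ 1 / 2) : ramp t = 0 := by
  rw [ramp, min_eq_right (by linarith), max_eq_left (by linarith)]

lemma ramp_eq_one {t : ℝ} (h : 3 / 5 ≤ t) : ramp t = 1 := by
  rw [ramp, min_eq_left (by linarith), max_eq_right zero_le_one]

lemma ramp_add_ramp_neg_le_one (t : ℝ) : ramp t + ramp (-t) ≤ 1 := by
  rcases le_total t 0 with h | h
  · rw [ramp_eq_zero (by linarith : t ≤ 1 / 2)]; linarith [ramp_le_one (-t)]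
  · rw [ramp_eq_zero (by linarith : -t ≤ 1 / 2)]; linarith [ramp_le_one t]

lemma ramp_add_ramp_neg_eq_one {t : ℝ} (h : 3 / 5 ≤ |t|) : ramp t + ramp (-t) = 1 := by
  rcases le_total t 0 with h0 | h0
  · rw [abs_of_nonpos h0] at h
    rw [ramp_eq_zero (by linarith : t ≤ 1 / 2), ramp_eq_one h, zero_add]
  · rw [abs_of_nonneg h0] at h
    rw [ramp_eq_zero (by linarith : -t ≤ 1 / 2), ramp_eq_one h, add_zero]

lemma ramp_partition {u v : ℝ} (h : u ^ 2 + v ^ 2 = 1) :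
    ramp u + ramp (-u) + (1 - ramp u - ramp (-u)) * ramp v
      + (1 - ramp u - ramp (-u)) * ramp (-v) = 1 := by
  rcases le_total (3 / 5) |u| with hu | hu
  · have := ramp_add_ramp_neg_eq_one hu
    linear_combination (1 - ramp v - ramp (-v)) * this
  · have hv : 3 / 5 ≤ |v| := by
      rw [← sq_abs u, ← sq_abs v] at h
      nlinarith [abs_nonneg u, abs_nonneg v]
    have := ramp_add_ramp_neg_eq_one hv
    linear_combination (1 - ramp u - ramp (-u)) * this

/-- A real continuous function viewed as a complex one. -/
def complexify {K : Type*} [TopologicalSpace K] (g : C(K, ℝ)) : C(K, ℂ) :=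
  ⟨fun x => (g x : ℂ), by fun_prop⟩

section Local

variable {K : Type*} [TopologicalSpace K]
  {B : C(K, ℂ) →ₗ[ℂ] C(K, ℂ) →ₗ[ℂ] ℂ}

lemma balanceDefect_eq_zero_of_separated
    (hloc : ∀ a b : C(K, ℂ), tsupport a ∩ tsupport b = ∅ → B a b = 0)
    {w b f : C(K, ℂ)} (h : tsupport w ∩ tsupport f = ∅) : balanceDefect B w b f = 0 := by
  have h1 : w * f = 0 := by
    ext x
    by_contra hx
    have hx' : w x ≠ 0 ∧ f x ≠ 0 := by simpa using hx
    exact (h ▸ ⟨subset_closure hx'.1, subset_closure hx'.2⟩ : x ∈ (∅ : Set K))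
  have h2 : B w (f * b) = 0 := by
    refine hloc _ _ (Set.eq_empty_of_subset_empty ?_)
    rw [← h]
    refine Set.inter_subset_inter_right _ (closure_mono fun x hx => ?_)
    simp only [Function.mem_support, ContinuousMap.mul_apply] at hx ⊢
    exact left_ne_zero_of_mul hx
  rw [balanceDefect_apply, h1, h2]
  simp

/-- The staircase `t - arcsin (sin t)`, composed with `g`. -/
noncomputable def staircase (g : C(K, ℝ)) : C(K, ℝ) :=
  ⟨fun x => g x - Real.arcsin (Real.sin (g x)), by fun_prop⟩

variable [CompactSpace K] {C : ℝ}

lemma norm_balanceDefect_le (hC : 0 ≤ C) (hB : ∀ a b, ‖B a b‖ ≤ C * ‖a‖ * ‖b‖)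
    (a b f : C(K, ℂ)) : ‖balanceDefect B a b f‖ ≤ 2 * C * ‖a‖ * ‖b‖ * ‖f‖ := by
  rw [balanceDefect_apply]
  have h1 : ‖B (a * f) b‖ ≤ C * (‖a‖ * ‖f‖) * ‖b‖ :=
    (hB _ _).trans (by gcongr; exact norm_mul_le _ _)
  have h2 : ‖B a (f * b)‖ ≤ C * ‖a‖ * (‖f‖ * ‖b‖) :=
    (hB _ _).trans (by gcongr; exact norm_mul_le _ _)
  linarith [norm_sub_le (B (a * f) b) (B a (f * b))]

lemma sum_mul_cutoff (g : C(K, ℝ)) (w : C(K, ℂ)) (hw : ∀ x, w x ≠ 0 → 1 / 2 ≤ Real.cos (g x)) :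
    ∃ s : Finset ℤ, ∑ k ∈ s, w * complexify
      ⟨fun x => cutoff (g x - k * (2 * Real.pi)), continuous_cutoff.comp (by fun_prop)⟩ = w := by
  obtain ⟨N, hN⟩ := exists_nat_ge (‖g‖ + 1)
  refine ⟨Finset.Icc (-N) N, ?_⟩
  ext x
  by_cases hx : w x = 0
  · simp [hx, ContinuousMap.sum_apply]
  have hpi := Real.pi_gt_three
  have hpi' := Real.pi_le_four
  have hpos : (0 : ℝ) < 2 * Real.pi := by positivity
  set k₀ : ℤ := round (g x / (2 * Real.pi)) with hk₀
  have hk : |g x - k₀ * (2 * Real.pi)| ≤ Real.pi := by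
    have := abs_sub_round (g x / (2 * Real.pi))
    have e : g x - k₀ * (2 * Real.pi) = (g x / (2 * Real.pi) - k₀) * (2 * Real.pi) := by
      field_simp
    rw [e, abs_mul, abs_of_pos hpos]
    nlinarith
  have hk3 : |g x - k₀ * (2 * Real.pi)| ≤ Real.pi / 3 :=
    abs_le_pi_div_three_of_half_le_cos hk (by rw [Real.cos_sub_int_mul_two_pi]; exact hw x hx)
  have hmem : k₀ ∈ Finset.Icc (-N : ℤ) N := by
    have hg : |g x| ≤ ‖g‖ := g.norm_coe_le_norm x
    have h1 := abs_le.1 hk3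
    have h2 := abs_le.1 hg
    rw [Finset.mem_Icc]
    constructor
    · have : (-N : ℝ) ≤ k₀ := by
        by_contra! hlt
        nlinarith
      exact_mod_cast this
    · have : (k₀ : ℝ) ≤ N := by
        by_contra! hlt
        nlinarith
      exact_mod_cast this
  rw [ContinuousMap.sum_apply, Finset.sum_eq_single_of_mem k₀ hmem]
  · simp [complexify, cutoff_eq_one (hk3.trans (by linarith))]
  · intro k _ hne
    have h1 : (1 : ℝ) ≤ |(k₀ : ℝ) - k| := by
      exact_mod_cast Int.one_le_abs (sub_ne_zero.2 hne.symm)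
    have h2 : 3 ≤ |g x - k * (2 * Real.pi)| := by
      have e : ((k₀ : ℝ) - k) * (2 * Real.pi)
          = (g x - k * (2 * Real.pi)) - (g x - k₀ * (2 * Real.pi)) := by ring
      have := abs_sub (g x - k * (2 * Real.pi)) (g x - k₀ * (2 * Real.pi))
      rw [← e, abs_mul, abs_of_pos hpos] at this
      nlinarith
    simp [complexify, cutoff_eq_zero h2]

lemma balanceDefect_staircase
    (hloc : ∀ a b : C(K, ℂ), tsupport a ∩ tsupport b = ∅ → B a b = 0)
    (g : C(K, ℝ)) (w b : C(K, ℂ)) (hw : ∀ x, w x ≠ 0 → 1 / 2 ≤ Real.cos (g x)) :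
    balanceDefect B w b (complexify (staircase g)) = 0 := by
  obtain ⟨s, hs⟩ := sum_mul_cutoff g w hw
  rw [← hs, balanceDefect_sum_left]
  refine Finset.sum_eq_zero fun k _ => ?_
  rw [← balanceDefect_add_smul_one B _ _ _ (-(k * (2 * Real.pi)) : ℂ)]
  apply balanceDefect_eq_zero_of_separated hloc
  have hpi := Real.pi_gt_three
  have h1 : ∀ x ∈ tsupport (w * complexify ⟨fun x => cutoff (g x - k * (2 * Real.pi)),
      continuous_cutoff.comp (by fun_prop)⟩), |g x - k * (2 * Real.pi)| ≤ Real.pi / 3 := by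
    refine closure_minimal (t := {x | |g x - k * (2 * Real.pi)| ≤ Real.pi / 3})
      (fun x hx => ?_) (isClosed_le (by fun_prop) (by fun_prop))
    have hx' : w x ≠ 0 ∧ cutoff (g x - k * (2 * Real.pi)) ≠ 0 := by
      simpa [complexify] using hx
    refine abs_le_pi_div_three_of_half_le_cos ?_
      (by rw [Real.cos_sub_int_mul_two_pi]; exact hw x hx'.1)
    by_contra! h
    exact hx'.2 (cutoff_eq_zero (by linarith))
  have h2 : ∀ x ∈ tsupport (complexify (staircase g) + (-(k * (2 * Real.pi)) : ℂ) • (1 : C(K, ℂ))),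
      Real.pi / 2 ≤ |g x - k * (2 * Real.pi)| := by
    refine closure_minimal (t := {x | Real.pi / 2 ≤ |g x - k * (2 * Real.pi)|})
      (fun x hx => ?_) (isClosed_le (by fun_prop) (by fun_prop))
    by_contra hn
    have h : |g x - k * (2 * Real.pi)| < Real.pi / 2 := not_le.1 hn
    apply hx
    have h' := abs_le.1 h.le
    have := Real.arcsin_sin h'.1 h'.2
    rw [Real.sin_sub_int_mul_two_pi] at this
    simp [complexify, staircase, this]
  refine Set.eq_empty_of_forall_notMem fun x hx => ?_
  linarith [h1 x hx.1, h2 x hx.2]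

lemma norm_balanceDefect_le_of_cos (hC : 0 ≤ C) (hB : ∀ a b, ‖B a b‖ ≤ C * ‖a‖ * ‖b‖)
    (hloc : ∀ a b : C(K, ℂ), tsupport a ∩ tsupport b = ∅ → B a b = 0)
    (g : C(K, ℝ)) (w b : C(K, ℂ)) (hw : ∀ x, w x ≠ 0 → 1 / 2 ≤ Real.cos (g x)) :
    ‖balanceDefect B w b (complexify g)‖ ≤ 2 * C * ‖w‖ * ‖b‖ * (Real.pi / 2) := by
  have h := balanceDefect_staircase hloc g w b hw
  rw [← sub_zero (balanceDefect B w b (complexify g)), ← h, ← map_sub]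
  refine (norm_balanceDefect_le hC hB _ _ _).trans ?_
  gcongr
  rw [ContinuousMap.norm_le _ (by positivity)]
  intro x
  have : (complexify g - complexify (staircase g)) x
      = (Real.arcsin (Real.sin (g x)) : ℂ) := by
    simp [complexify, staircase]
  rw [this, Complex.norm_real, Real.norm_eq_abs, abs_le]
  exact ⟨Real.neg_pi_div_two_le_arcsin _, Real.arcsin_le_pi_div_two _⟩

lemma norm_balanceDefect_mul_le (hC : 0 ≤ C) (hB : ∀ a b, ‖B a b‖ ≤ C * ‖a‖ * ‖b‖)
    (hloc : ∀ a b : C(K, ℂ), tsupport a ∩ tsupport b = ∅ → B a b = 0)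
    (g ψ : C(K, ℝ)) (a b : C(K, ℂ)) (c : ℝ) (h0 : ∀ x, 0 ≤ ψ x) (h1 : ∀ x, ψ x ≤ 1)
    (hψ : ∀ x, Real.cos (g x + c) ≤ 1 / 2 → ψ x = 0) :
    ‖balanceDefect B (a * complexify ψ) b (complexify g)‖
      ≤ 2 * C * ‖a‖ * ‖b‖ * (Real.pi / 2) := by
  have e : complexify (⟨fun x => g x + c, by fun_prop⟩ : C(K, ℝ))
      = complexify g + (c : ℂ) • 1 := by
    ext x; simp [complexify]
  rw [← balanceDefect_add_smul_one B _ _ _ (c : ℂ), ← e]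
  refine (norm_balanceDefect_le_of_cos hC hB hloc _ _ _ fun x hx => ?_).trans ?_
  · by_contra! h
    exact hx (by simp [complexify, hψ x h.le])
  · gcongr
    rw [ContinuousMap.norm_le _ (by positivity)]
    intro x
    rw [ContinuousMap.mul_apply, norm_mul, ← mul_one ‖a‖]
    gcongr
    · exact a.norm_coe_le_norm x
    · simpa [complexify, abs_of_nonneg (h0 x)] using h1 x

lemma norm_balanceDefect_le_uniform (hC : 0 ≤ C) (hB : ∀ a b, ‖B a b‖ ≤ C * ‖a‖ * ‖b‖)
    (hloc : ∀ a b : C(K, ℂ), tsupport a ∩ tsupport b = ∅ → B a b = 0)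
    (g : C(K, ℝ)) (a b : C(K, ℂ)) :
    ‖balanceDefect B a b (complexify g)‖ ≤ 4 * (2 * C * ‖a‖ * ‖b‖ * (Real.pi / 2)) := by
  have hr := continuous_ramp
  let ψ₁ : C(K, ℝ) := ⟨fun x => ramp (Real.cos (g x)), by fun_prop⟩
  let ψ₂ : C(K, ℝ) := ⟨fun x => ramp (-Real.cos (g x)), by fun_prop⟩
  let ψ₃ : C(K, ℝ) := ⟨fun x => (1 - ramp (Real.cos (g x)) - ramp (-Real.cos (g x)))
    * ramp (Real.sin (g x)), by fun_prop⟩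
  let ψ₄ : C(K, ℝ) := ⟨fun x => (1 - ramp (Real.cos (g x)) - ramp (-Real.cos (g x)))
    * ramp (-Real.sin (g x)), by fun_prop⟩
  have hr0 : ∀ t, 0 ≤ 1 - ramp t - ramp (-t) := fun t => by
    linarith [ramp_add_ramp_neg_le_one t]
  have hr1 : ∀ t, 1 - ramp t - ramp (-t) ≤ 1 := fun t => by
    linarith [ramp_nonneg t, ramp_nonneg (-t)]
  have hsum : a = a * complexify ψ₁ + a * complexify ψ₂ + a * complexify ψ₃
      + a * complexify ψ₄ := by
    ext x
    have h := ramp_partition (Real.cos_sq_add_sin_sq (g x))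
    have h' := congrArg (fun t : ℝ => (t : ℂ)) h
    simp only [Complex.ofReal_add, Complex.ofReal_one] at h'
    change a x = a x * (ψ₁ x : ℂ) + a x * (ψ₂ x : ℂ) + a x * (ψ₃ x : ℂ) + a x * (ψ₄ x : ℂ)
    rw [← mul_add, ← mul_add, ← mul_add]
    exact (mul_one (a x)).symm.trans (congrArg _ h'.symm)
  have b₁ := norm_balanceDefect_mul_le hC hB hloc g ψ₁ a b 0 (fun x => ramp_nonneg _)
    (fun x => ramp_le_one _) (fun x hx => ramp_eq_zero (by simpa using hx))
  have b₂ := norm_balanceDefect_mul_le hC hB hloc g ψ₂ a b Real.pi (fun x => ramp_nonneg _)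
    (fun x => ramp_le_one _) (fun x hx => ramp_eq_zero (by simpa using hx))
  have b₃ := norm_balanceDefect_mul_le hC hB hloc g ψ₃ a b (-(Real.pi / 2))
    (fun x => mul_nonneg (hr0 _) (ramp_nonneg _))
    (fun x => mul_le_one₀ (hr1 _) (ramp_nonneg _) (ramp_le_one _))
    (fun x hx => mul_eq_zero_of_right _ (ramp_eq_zero (by
      simpa [← sub_eq_add_neg, Real.cos_sub_pi_div_two] using hx)))
  have b₄ := norm_balanceDefect_mul_le hC hB hloc g ψ₄ a b (Real.pi / 2)
    (fun x => mul_nonneg (hr0 _) (ramp_nonneg _))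
    (fun x => mul_le_one₀ (hr1 _) (ramp_nonneg _) (ramp_le_one _))
    (fun x hx => mul_eq_zero_of_right _ (ramp_eq_zero (by
      simpa [Real.cos_add_pi_div_two] using hx)))
  rw [hsum, balanceDefect_add_left, balanceDefect_add_left, balanceDefect_add_left, ← hsum]
  refine (norm_add₄_le).trans ?_
  linarith

lemma balanceDefect_complexify_eq_zero (hC : 0 ≤ C) (hB : ∀ a b, ‖B a b‖ ≤ C * ‖a‖ * ‖b‖)
    (hloc : ∀ a b : C(K, ℂ), tsupport a ∩ tsupport b = ∅ → B a b = 0)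
    (g : C(K, ℝ)) (a b : C(K, ℂ)) : balanceDefect B a b (complexify g) = 0 := by
  by_contra hne
  have hpos := norm_pos_iff.2 hne
  obtain ⟨n, hn⟩ := exists_nat_gt
    (4 * (2 * C * ‖a‖ * ‖b‖ * (Real.pi / 2)) / ‖balanceDefect B a b (complexify g)‖)
  rw [div_lt_iff₀ hpos] at hn
  have h := norm_balanceDefect_le_uniform hC hB hloc ((n : ℝ) • g) a b
  have e : complexify ((n : ℝ) • g) = (n : ℂ) • complexify g := by
    ext x; simp [complexify]
  rw [e, map_smul, norm_smul, Complex.norm_natCast] at h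
  linarith

/-- A bounded bilinear form on `C(K, ℂ)` vanishing on pairs of functions with disjoint supports
is balanced over `C(K, ℂ)`. -/
theorem map_mul_left_eq_map_mul_right (hC : 0 ≤ C) (hB : ∀ a b, ‖B a b‖ ≤ C * ‖a‖ * ‖b‖)
    (hloc : ∀ a b : C(K, ℂ), tsupport a ∩ tsupport b = ∅ → B a b = 0)
    (a b f : C(K, ℂ)) : B (a * f) b = B a (f * b) := by
  have hf : f = complexify ⟨fun x => (f x).re, by fun_prop⟩
      + Complex.I • complexify ⟨fun x => (f x).im, by fun_prop⟩ := by
    ext x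
    simp [complexify, mul_comm Complex.I, Complex.re_add_im]
  rw [← sub_eq_zero, ← balanceDefect_apply, hf, map_add, map_smul,
    balanceDefect_complexify_eq_zero hC hB hloc, balanceDefect_complexify_eq_zero hC hB hloc]
  simp

end Local

section Multilinear

open Function

variable {K : Type*} [TopologicalSpace K] [CompactSpace K] {ι : Type*} [Fintype ι] [DecidableEq ι]
  (E : ContinuousMultilinearMap ℂ (fun _ : ι => C(K, ℂ)) ℂ)

lemma map_update_mul_update (hloc : ∀ y : ι → C(K, ℂ), (⋂ j, tsupport (y j)) = ∅ → E y = 0)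
    {i j : ι} (hij : i ≠ j) (y : ι → C(K, ℂ)) (a b f : C(K, ℂ)) :
    E (update (update y i (a * f)) j b) = E (update (update y i a) j (f * b)) := by
  let B : C(K, ℂ) →ₗ[ℂ] C(K, ℂ) →ₗ[ℂ] ℂ :=
    LinearMap.mk₂ ℂ (fun a b => E (update (update y i a) j b))
      (fun a a' b => by simp only [update_comm hij, E.map_update_add])
      (fun c a b => by simp only [update_comm hij, E.map_update_smul])
      (fun a b b' => E.map_update_add _ _ _ _) (fun c a b => E.map_update_smul _ _ _ _)
  refine map_mul_left_eq_map_mul_right (B := B)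
    (C := ‖E‖ * ∏ k ∈ (Finset.univ \ {j}) \ {i}, ‖y k‖) (by positivity) ?_ ?_ a b f
  · intro a b
    refine (E.le_opNorm _).trans_eq ?_
    have e : (fun k => ‖update (update y i a) j b k‖)
        = update (update (fun k => ‖y k‖) i ‖a‖) j ‖b‖ := by
      ext k
      simp only [update_apply]
      split_ifs <;> rfl
    rw [e, Finset.prod_update_of_mem (Finset.mem_univ j),
      Finset.prod_update_of_mem (by simpa using hij)]
    ring
  · intro a b hab
    refine hloc _ (Set.eq_empty_of_subset_empty ?_)
    rw [← hab]
    intro x hx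
    rw [Set.mem_iInter] at hx
    exact ⟨by simpa [hij] using hx i, by simpa using hx j⟩

/-- A continuous multilinear form on `C(K, ℂ)` vanishing on tuples with empty common support
factors through the product. -/
theorem map_eq_map_update_one_prod
    (hloc : ∀ y : ι → C(K, ℂ), (⋂ j, tsupport (y j)) = ∅ → E y = 0)
    (i : ι) (y : ι → C(K, ℂ)) : E y = E (update 1 i (∏ j, y j)) := by
  have key : ∀ s : Finset ι, i ∉ s →
      E y = E (update (fun k => if k ∈ s then 1 else y k) i (y i * ∏ k ∈ s, y k)) := by
    intro s
    induction s using Finset.induction_on with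
    | empty => simp
    | insert j s hj ih =>
      intro hi
      rw [Finset.mem_insert, not_or] at hi
      rw [ih hi.2]
      have h := map_update_mul_update E hloc hi.1 (fun k => if k ∈ s then 1 else y k)
        (y i * ∏ k ∈ s, y k) 1 (y j)
      convert h.symm using 2
      · ext1 k
        simp only [update_apply]
        grind
      · ext1 k
        simp only [update_apply, Finset.prod_insert hj]
        grind
  rw [key (Finset.univ.erase i) (by simp), Finset.mul_prod_erase _ _ (Finset.mem_univ i)]
  congr 1
  ext1 k
  by_cases h : k = i <;> simp [h]

end Multilinear

lemma integral_fourier_eq_zero {n : ℤ} (hn : n ≠ 0) :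
    ∫ t : AddCircle (1 : ℝ), fourier n t = 0 :=
  integral_eq_zero_of_add_right_eq_neg (fourier_add_half_inv_index hn one_pos)

/-- A linear functional killing the `m`-th powers of all `α • p + q` kills `p * q ^ (m - 1)`. -/
lemma map_mul_pow_eq_zero {A : Type*} [CommRing A] [Algebra ℂ A] (L : A →ₗ[ℂ] ℂ) {n : ℕ}
    {p q : A} (h : ∀ α : ℂ, L ((α • p + q) ^ (n + 1)) = 0) : L (p * q ^ n) = 0 := by
  let P : Polynomial ℂ := ∑ k ∈ Finset.range (n + 2),
    Polynomial.monomial k (((n + 1).choose k : ℂ) * L (p ^ k * q ^ (n + 1 - k)))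
  have hP : P = 0 := by
    refine Polynomial.funext fun α => ?_
    rw [Polynomial.eval_zero, ← h α, add_pow, map_sum, Polynomial.eval_finsetSum]
    refine Finset.sum_congr rfl fun k _ => ?_
    rw [Polynomial.eval_monomial, smul_pow, smul_mul_assoc, ← nsmul_eq_mul', map_nsmul, map_smul,
      nsmul_eq_mul, smul_eq_mul]
    ring
  have h1 := congrArg (fun Q => Polynomial.coeff Q 1) hP
  simp only [P, Polynomial.finsetSum_coeff, Polynomial.coeff_monomial, Finset.sum_ite_eq',
    Polynomial.coeff_zero] at h1
  have hn : (n : ℂ) + 1 ≠ 0 := Nat.cast_add_one_ne_zero n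
  simpa [hn] using h1

lemma map_fourier_eq_zero (L : C(AddCircle (1 : ℝ), ℂ) →ₗ[ℂ] ℂ) {n : ℕ} (hn : n ≠ 0)
    (h : ∀ x : C(AddCircle (1 : ℝ), ℂ), (∫ t, x t) = 0 → L (x ^ (n + 1)) = 0) (k : ℤ) :
    L (fourier k) = 0 := by
  obtain ⟨p, q, hp, hq, rfl⟩ : ∃ p q : ℤ, p ≠ 0 ∧ q ≠ 0 ∧ p + n * q = k := by
    by_cases hk : k = n
    · exact ⟨2 * n, -1, by lia, by lia, by lia⟩
    · exact ⟨k - n, 1, by lia, by lia, by lia⟩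
  have hf : fourier (T := (1 : ℝ)) (p + n * q) = fourier p * fourier q ^ n := by
    ext x
    simp [fourier_apply, add_zsmul, mul_zsmul, AddCircle.toCircle_add, AddCircle.toCircle_nsmul]
  rw [hf]
  refine map_mul_pow_eq_zero L fun α => h _ ?_
  have hi : ∀ y : C(AddCircle (1 : ℝ), ℂ), Integrable y := fun y =>
    y.continuous.integrable_of_hasCompactSupport (HasCompactSupport.of_compactSpace _)
  have := integral_add ((hi (fourier p)).const_mul α) (hi (fourier q))
  rw [integral_const_mul, integral_fourier_eq_zero hp, integral_fourier_eq_zero hq, mul_zero,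
    add_zero] at this
  exact this

/-- The kernel computation in the proof of Proposition 1.3: a continuous symmetric
`m`-multilinear form (`m ≥ 2`) on `C(S¹, ℂ)` which vanishes on tuples with empty
common support and whose associated homogeneous polynomial vanishes on mean-zero
functions is identically zero. -/
theorem multilinear_eq_zero_of_additive_and_vanishing_on_mean_zero
    (m : ℕ) (hm : 2 ≤ m)
    (ℰ : ContinuousMultilinearMap ℂ
      (fun _ : Fin m => C(AddCircle (1 : ℝ), ℂ)) ℂ)
    (hsymm : ∀ (σ : Equiv.Perm (Fin m)) (y : Fin m → C(AddCircle (1 : ℝ), ℂ)),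
      ℰ (fun j => y (σ j)) = ℰ y)
    (hadd : ∀ y : Fin m → C(AddCircle (1 : ℝ), ℂ),
      (⋂ j, tsupport ⇑(y j)) = ∅ → ℰ y = 0)
    (hvanish : ∀ x : C(AddCircle (1 : ℝ), ℂ),
      (∫ t : AddCircle (1 : ℝ), x t) = 0 → ℰ (fun _ => x) = 0) :
    ℰ = 0 := by
  obtain ⟨n, rfl⟩ : ∃ n, m = n + 1 := ⟨m - 1, by lia⟩
  have hprod := map_eq_map_update_one_prod ℰ hadd 0
  let L := ℰ.toContinuousLinearMap 1 0
  have hL : ∀ y, ℰ y = L (∏ j, y j) := hprod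
  have hfourier : ∀ k, L (fourier k) = 0 := by
    refine map_fourier_eq_zero (L : _ →ₗ[ℂ] ℂ) (n := n) (by lia) fun x hx => ?_
    have := hL fun _ => x
    rw [hvanish x hx, Finset.prod_const, Finset.card_univ, Fintype.card_fin] at this
    exact this.symm
  have hL0 : L = 0 := by
    refine ContinuousLinearMap.ext_on (s := Set.range (@fourier (1 : ℝ))) ?_ ?_
    · rw [Submodule.dense_iff_topologicalClosure_eq_top]
      exact span_fourier_closure_eq_top
    · rintro _ ⟨k, rfl⟩
      simpa using hfourier k
  ext y
  rw [hL, hL0]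
  rfl
end

section
/- Let F : ℂ × C(S¹,ℂ) → ℂ be an analytic function (in the sense of analytic maps between complex Banach spaces) satisfying: (1) for every (ζ,y) ∈ ℂ × C(S¹,ℂ), F(ζ/λ, λ²y) = O(λ²) as ℂ∖{0} ∋ λ → 0; (2) F(ζ, x+y) = F(ζ,x) + F(ζ,y) for all ζ whenever supp x ∩ supp y = ∅; (3) F(ζ, x) = 0 for all ζ whenever ∫_{S¹} x = 0. Then there is a constant c ∈ ℂ such that F(ζ, x) = c ∫_{S¹} x for all ζ ∈ ℂ and x ∈ C(S¹,ℂ). -/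
open MeasureTheory Asymptotics Filter

section ContinuousFunctions

variable {X : Type*} [TopologicalSpace X] [CompactSpace X]

/-- Continuous functions vanishing at a point can be uniformly approximated by continuous
functions vanishing near that point. -/
theorem ContinuousMap.exists_norm_sub_le_notMem_tsupport {x : C(X, ℂ)} {p : X} (hp : x p = 0)
    {δ : ℝ} (hδ : 0 < δ) : ∃ y : C(X, ℂ), ‖y - x‖ ≤ δ ∧ p ∉ tsupport y := by
  have hm : ∀ t, 0 < max ‖x t‖ δ := fun t => lt_max_of_lt_right hδ
  have hc : Continuous fun t => δ / max ‖x t‖ δ :=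
    Continuous.div (by fun_prop) (by fun_prop) fun t => (hm t).ne'
  refine ⟨⟨fun t => x t * (1 - ((δ / max ‖x t‖ δ : ℝ) : ℂ)), ?_⟩, ?_, ?_⟩
  · exact x.continuous.mul (continuous_const.sub (Complex.continuous_ofReal.comp hc))
  · refine (ContinuousMap.norm_le _ hδ.le).2 fun t => ?_
    have h : x t * (1 - ((δ / max ‖x t‖ δ : ℝ) : ℂ)) - x t =
        -(x t * ((δ / max ‖x t‖ δ : ℝ) : ℂ)) := by ring
    rw [ContinuousMap.sub_apply, ContinuousMap.coe_mk, h, norm_neg, norm_mul, Complex.norm_real,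
      Real.norm_of_nonneg (div_pos hδ (hm t)).le, mul_div_assoc', div_le_iff₀ (hm t), mul_comm]
    gcongr
    exact le_max_left _ _
  · rw [notMem_tsupport_iff_eventuallyEq]
    have : ∀ᶠ t in nhds p, ‖x t‖ < δ :=
      (x.continuous.norm.tendsto p).eventually_lt_const (by simpa [hp] using hδ)
    filter_upwards [this] with t ht
    simp [max_eq_right ht.le, hδ.ne']

variable [T2Space X]

theorem exists_tsupport_subset_integral_eq_one [MeasurableSpace X] [BorelSpace X]
    (μ : Measure X) [IsFiniteMeasure μ] [μ.IsOpenPosMeasure] {U : Set X} (hU : IsOpen U)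
    {p : X} (hp : p ∈ U) :
    ∃ φ : C(X, ℂ), tsupport φ ⊆ U ∧ ∫ t, φ t ∂μ = 1 := by
  obtain ⟨f, hfU, hfp, hf⟩ := exists_tsupport_one_of_isOpen_isClosed hU
    isClosed_closure.isCompact isClosed_singleton (Set.singleton_subset_iff.2 hp)
  have hpos : 0 < ∫ t, f t ∂μ :=
    f.continuous.integral_pos_of_hasCompactSupport_nonneg_nonzero
      (HasCompactSupport.of_compactSpace f) (fun t => (hf t).1) (x := p)
      (by rw [hfp rfl]; simp)
  refine ⟨⟨fun t => ((f t : ℝ) : ℂ) * ((∫ t, f t ∂μ : ℝ) : ℂ)⁻¹, by fun_prop⟩, ?_, ?_⟩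
  · refine (closure_mono fun t ht => ?_).trans hfU
    contrapose! ht
    simp [Function.notMem_support.1 ht]
  · have hne : ((∫ t, f t ∂μ : ℝ) : ℂ) ≠ 0 := by exact_mod_cast hpos.ne'
    simp only [ContinuousMap.coe_mk]
    rw [integral_mul_const, integral_complex_ofReal]
    exact mul_inv_cancel₀ hne

variable [ConnectedSpace X] [Nontrivial X]

theorem exists_disjoint_tsupport_integral_eq_one [MeasurableSpace X] [BorelSpace X]
    (μ : Measure X) [IsFiniteMeasure μ] [μ.IsOpenPosMeasure] {S : Set X} (hS : IsClosed S)
    {p : X} (hp : p ∉ S) :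
    ∃ φ ψ : C(X, ℂ), Disjoint S (tsupport φ) ∧ Disjoint S (tsupport ψ) ∧
      Disjoint (tsupport φ) (tsupport ψ) ∧ ∫ t, φ t ∂μ = 1 ∧ ∫ t, ψ t ∂μ = 1 := by
  obtain ⟨q, hq, hqp⟩ :=
    (infinite_of_mem_nhds p (hS.isOpen_compl.mem_nhds hp)).nontrivial.exists_ne p
  obtain ⟨U, V, hU, hV, hpU, hqV, hUV⟩ := t2_separation hqp.symm
  obtain ⟨φ, hφ, hφ1⟩ := exists_tsupport_subset_integral_eq_one μ
    (hU.inter hS.isOpen_compl) ⟨hpU, hp⟩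
  obtain ⟨ψ, hψ, hψ1⟩ := exists_tsupport_subset_integral_eq_one μ
    (hV.inter hS.isOpen_compl) ⟨hqV, hq⟩
  exact ⟨φ, ψ, (Set.subset_compl_iff_disjoint_left.1 fun t ht => (hφ ht).2),
    (Set.subset_compl_iff_disjoint_left.1 fun t ht => (hψ ht).2),
    hUV.mono (fun t ht => (hφ ht).1) (fun t ht => (hψ ht).1), hφ1, hψ1⟩

/-- Two entire functions on `C(X, ℂ)` agreeing on functions that have a zero are equal. -/
theorem eq_of_eq_on_zeros {G L : C(X, ℂ) → ℂ} (hG : Differentiable ℂ G) (hL : Differentiable ℂ L)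
    (h : ∀ (x : C(X, ℂ)) (p : X), x p = 0 → G x = L x) : G = L := by
  have key : ∀ x : C(X, ℂ), (Set.range x).Nontrivial → G x = L x := by
    intro x hx
    obtain ⟨z, hz⟩ := hx.nonempty
    have hacc := (isPreconnected_range x.continuous).preperfect_of_nontrivial hx z hz
    rw [accPt_iff_frequently_nhdsNE] at hacc
    have hline : Differentiable ℂ fun s : ℂ => x - s • (1 : C(X, ℂ)) := by fun_prop
    have := AnalyticOnNhd.eq_of_frequently_eq (z₀ := z)
      (fun s _ => (hG.comp hline).analyticAt s) (fun s _ => (hL.comp hline).analyticAt s)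
      (hacc.mono (by rintro _ ⟨p, rfl⟩; exact h _ p (by simp)))
    simpa using congrFun this 0
  funext x
  by_cases hx : (Set.range x).Nontrivial
  · exact key x hx
  obtain ⟨p, q, hpq⟩ := exists_pair_ne X
  have hxpq : x p = x q := Set.not_nontrivial_iff.1 hx ⟨p, rfl⟩ ⟨q, rfl⟩
  obtain ⟨f, hfp, hfq, -⟩ := exists_continuous_zero_one_of_isClosed
    (isClosed_singleton (x := p)) (isClosed_singleton (x := q)) (by simpa using hpq)
  let φ : C(X, ℂ) := ⟨fun t => (f t : ℂ), by fun_prop⟩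
  have hp : φ p = 0 := by simp [φ, hfp rfl]
  have hq : φ q = 1 := by simp [φ, hfq rfl]
  have hline : Continuous fun s : ℂ => x + s • φ := by fun_prop
  have := Continuous.ext_on (dense_compl_singleton (0 : ℂ)) (hG.continuous.comp hline)
    (hL.continuous.comp hline) fun s hs => key _
      ⟨_, ⟨p, rfl⟩, _, ⟨q, rfl⟩, by simpa [hp, hq, hxpq, eq_comm] using hs⟩
  simpa using congrFun this 0

end ContinuousFunctions

theorem eq_mul_deriv_zero_of_map_add {h : ℂ → ℂ} (hd : Differentiable ℂ h)
    (hadd : ∀ s t, h (s + t) = h s + h t) (s : ℂ) : h s = s * deriv h 0 := by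
  have h0 : h 0 = 0 := by simpa using hadd 0 0
  have hderiv : ∀ s, deriv h s = deriv h 0 := by
    intro s
    have h1 : deriv (fun t => h (s + t)) 0 = deriv h s := by
      rw [deriv_comp_const_add]; simp
    rw [← h1, funext (hadd s)]
    simp
  have := is_const_of_deriv_eq_zero (f := fun s => h s - s * deriv h 0)
    (by fun_prop) (fun s => by
      rw [deriv_fun_sub (hd s) (by fun_prop), hderiv s]; simp) s 0
  simpa [h0, sub_eq_zero] using this

section AdditiveOnDisjointSupports

variable {X : Type*} [TopologicalSpace X] [CompactSpace X] [T2Space X] [ConnectedSpace X]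
  [Nontrivial X] [MeasurableSpace X] [BorelSpace X] (μ : Measure X) [IsFiniteMeasure μ]
  [μ.IsOpenPosMeasure]

/-- A function on `C(X, ℂ)` which is additive on disjointly supported functions and
vanishes on mean-zero functions is additive on multiples of a function whose support is not the
whole space. -/
theorem map_add_smul_of_notMem_tsupport {G : C(X, ℂ) → ℂ}
    (hadd : ∀ x y : C(X, ℂ), Disjoint (tsupport x) (tsupport y) → G (x + y) = G x + G y)
    (hzero : ∀ x : C(X, ℂ), ∫ t, x t ∂μ = 0 → G x = 0)
    {x : C(X, ℂ)} {p : X} (hp : p ∉ tsupport x) (s t : ℂ) :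
    G ((s + t) • x) = G (s • x) + G (t • x) := by
  have hint (z : C(X, ℂ)) : Integrable z μ :=
    z.continuous.integrable_of_hasCompactSupport (HasCompactSupport.of_compactSpace z)
  have hsupp (a : ℂ) (z : C(X, ℂ)) : tsupport (a • z) ⊆ tsupport z :=
    tsupport_smul_subset_right (fun _ => a) z
  have hcancel (u v : C(X, ℂ)) (huv : Disjoint (tsupport u) (tsupport v))
      (h : ∫ t, u t ∂μ + ∫ t, v t ∂μ = 0) : G u = -G v := by
    rw [eq_neg_iff_add_eq_zero, ← hadd u v huv]
    exact hzero _ (by simpa [integral_add (hint u) (hint v)] using h)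
  obtain ⟨φ, ψ, hxφ, hxψ, hφψ, hφ, hψ⟩ :=
    exists_disjoint_tsupport_integral_eq_one μ (isClosed_tsupport x) hp
  set m := ∫ t, x t ∂μ with hm
  have hs : G (s • x) = -G ((-(s * m)) • φ) :=
    hcancel _ _ (hxφ.mono (hsupp _ _) (hsupp _ _)) (by
      simp only [ContinuousMap.coe_smul, Pi.smul_apply, smul_eq_mul, integral_const_mul, hφ,
        ← hm]; ring)
  have ht : G (t • x) = -G ((-(t * m)) • ψ) :=
    hcancel _ _ (hxψ.mono (hsupp _ _) (hsupp _ _)) (by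
      simp only [ContinuousMap.coe_smul, Pi.smul_apply, smul_eq_mul, integral_const_mul, hψ,
        ← hm]; ring)
  have hst : G ((s + t) • x) = -G ((-(s * m)) • φ + (-(t * m)) • ψ) := by
    refine hcancel _ _ ?_ ?_
    · refine Disjoint.mono (hsupp _ _) (tsupport_add _ _) (Set.disjoint_union_right.2 ⟨?_, ?_⟩)
      · exact hxφ.mono_right (hsupp _ _)
      · exact hxψ.mono_right (hsupp _ _)
    · have := integral_add (hint ((-(s * m)) • φ)) (hint ((-(t * m)) • ψ))
      simp only [ContinuousMap.coe_smul, ContinuousMap.coe_add, Pi.add_apply, Pi.smul_apply,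
        smul_eq_mul, integral_const_mul, hφ, hψ, ← hm] at this ⊢
      rw [this]
      ring
  rw [hst, hs, ht, hadd _ _ (hφψ.mono (hsupp _ _) (hsupp _ _))]
  ring

/-- An entire function on `C(X, ℂ)` which is additive on disjointly supported functions and
vanishes on mean-zero functions is linear. -/
theorem eq_fderiv_zero_of_map_add {G : C(X, ℂ) → ℂ} (hG : Differentiable ℂ G)
    (hadd : ∀ x y : C(X, ℂ), Disjoint (tsupport x) (tsupport y) → G (x + y) = G x + G y)
    (hzero : ∀ x : C(X, ℂ), ∫ t, x t ∂μ = 0 → G x = 0) : G = fderiv ℂ G 0 := by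
  refine eq_of_eq_on_zeros hG (fderiv ℂ G 0).differentiable fun x p hp => ?_
  have hclosed : IsClosed {x | G x = fderiv ℂ G 0 x} :=
    isClosed_eq hG.continuous (fderiv ℂ G 0).continuous
  refine closure_minimal (s := {x : C(X, ℂ) | p ∉ tsupport x}) (fun y hy => ?_) hclosed
    (Metric.mem_closure_iff.2 fun ε hε => ?_)
  · have hline : HasDerivAt (fun s : ℂ => s • y) y 0 := by
      simpa using (hasDerivAt_id (0 : ℂ)).smul_const y
    have hd : HasDerivAt (fun s : ℂ => G (s • y)) (fderiv ℂ G 0 y) 0 := by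
      refine HasFDerivAt.comp_hasDerivAt (0 : ℂ) ?_ hline
      simpa using (hG 0).hasFDerivAt
    have := eq_mul_deriv_zero_of_map_add (h := fun s : ℂ => G (s • y))
      (hG.comp (by fun_prop)) (map_add_smul_of_notMem_tsupport μ hadd hzero hy) 1
    simpa [hd.deriv] using this
  · obtain ⟨y, hy, hyp⟩ := ContinuousMap.exists_norm_sub_le_notMem_tsupport hp (half_pos hε)
    exact ⟨y, hyp, by rw [dist_comm, dist_eq_norm]; linarith⟩

/-- An entire function on `C(X, ℂ)` which is additive on disjointly supported functions and
vanishes on mean-zero functions is a multiple of the integral. -/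
theorem eq_map_one_mul_integral_of_map_add [IsProbabilityMeasure μ] {G : C(X, ℂ) → ℂ}
    (hG : Differentiable ℂ G)
    (hadd : ∀ x y : C(X, ℂ), Disjoint (tsupport x) (tsupport y) → G (x + y) = G x + G y)
    (hzero : ∀ x : C(X, ℂ), ∫ t, x t ∂μ = 0 → G x = 0) (x : C(X, ℂ)) :
    G x = G 1 * ∫ t, x t ∂μ := by
  have hlin := eq_fderiv_zero_of_map_add μ hG hadd hzero
  have hx : G (x - (∫ t, x t ∂μ) • (1 : C(X, ℂ))) = 0 := by
    refine hzero _ ?_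
    have hint : Integrable x μ :=
      x.continuous.integrable_of_hasCompactSupport (HasCompactSupport.of_compactSpace x)
    simp [integral_sub hint (integrable_const _)]
  rw [hlin, map_sub, map_smul, ← hlin, sub_eq_zero] at hx
  rw [hx, smul_eq_mul, mul_comm]

end AdditiveOnDisjointSupports

/-- An entire function which is bounded near infinity is constant. -/
theorem Differentiable.apply_eq_apply_of_isBigO_one {f : ℂ → ℂ} (hf : Differentiable ℂ f)
    (hb : f =O[cocompact ℂ] (1 : ℂ → ℂ)) (z w : ℂ) : f z = f w := by
  refine hf.apply_eq_apply_of_bounded ?_ z w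
  obtain ⟨C, hC⟩ := hb.bound
  obtain ⟨t, ht, hts⟩ := mem_cocompact.1 hC
  refine ((ht.image hf.continuous).isBounded.union
    (Metric.isBounded_closedBall (x := (0 : ℂ)) (r := C))).subset ?_
  rintro _ ⟨z, rfl⟩
  by_cases hz : z ∈ t
  · exact Or.inl ⟨z, hz, rfl⟩
  · exact Or.inr (by simpa using hts hz)

/-- The kernel description in Theorem 1.1 (for `C¹` loop spaces): an analytic function
`F : ℂ × C(S¹, ℂ) → ℂ` satisfying the growth condition (1), additivity (2), and
vanishing on mean-zero functions must be a constant multiple of `(ζ, x) ↦ ∫_{S¹} x`. -/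
theorem kernel_of_tildeF
    (F : ℂ × C(AddCircle (1 : ℝ), ℂ) → ℂ)
    (hF : ∀ p, AnalyticAt ℂ F p)
    (h1 : ∀ (ζ : ℂ) (y : C(AddCircle (1 : ℝ), ℂ)),
      (fun lam : ℂ => F (ζ / lam, lam ^ 2 • y)) =O[nhdsWithin 0 {(0 : ℂ)}ᶜ]
        (fun lam : ℂ => lam ^ 2))
    (h2 : ∀ (ζ : ℂ) (x y : C(AddCircle (1 : ℝ), ℂ)),
      tsupport ⇑x ∩ tsupport ⇑y = ∅ → F (ζ, x + y) = F (ζ, x) + F (ζ, y))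
    (h3 : ∀ (ζ : ℂ) (x : C(AddCircle (1 : ℝ), ℂ)),
      (∫ t : AddCircle (1 : ℝ), x t) = 0 → F (ζ, x) = 0) :
    ∃ c : ℂ, ∀ (ζ : ℂ) (x : C(AddCircle (1 : ℝ), ℂ)),
      F (ζ, x) = c * ∫ t : AddCircle (1 : ℝ), x t := by
  have hdiff : Differentiable ℂ F := fun p => (hF p).differentiableAt
  have : IsProbabilityMeasure (volume : Measure (AddCircle (1 : ℝ))) :=
    ⟨by simp [AddCircle.measure_univ]⟩
  have : Nontrivial (AddCircle (1 : ℝ)) :=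
    (AddCircle.equivIco (1 : ℝ) 0).nontrivial_congr.2
      ⟨⟨0, by norm_num⟩, ⟨1 / 2, by norm_num⟩, by simp⟩
  have hform (ζ : ℂ) (x : C(AddCircle (1 : ℝ), ℂ)) :
      F (ζ, x) = F (ζ, 1) * ∫ t : AddCircle (1 : ℝ), x t :=
    eq_map_one_mul_integral_of_map_add volume (G := fun x => F (ζ, x))
      (hdiff.comp (by fun_prop))
      (fun x y hxy => h2 ζ x y hxy.inter_eq) (h3 ζ) x
  refine ⟨F (0, 1), fun ζ x => ?_⟩
  rw [hform ζ x]
  congr 1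
  refine Differentiable.apply_eq_apply_of_isBigO_one (f := fun ζ => F (ζ, 1))
    (hdiff.comp (by fun_prop)) ?_ ζ 0
  have hscale (lam : ℂ) : F (1 / lam, lam ^ 2 • 1) = F (lam⁻¹, 1) * lam ^ 2 := by
    rw [hform]
    simp
  have hbound : (fun lam : ℂ => F (lam⁻¹, 1)) =O[nhdsWithin 0 {(0 : ℂ)}ᶜ] (1 : ℂ → ℂ) := by
    refine ((h1 1 1).mul (isBigO_refl (fun lam : ℂ => (lam ^ 2)⁻¹) _)).congr' ?_ ?_ <;>
    · filter_upwards [self_mem_nhdsWithin] with lam hlam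
      have : lam ≠ 0 := hlam
      simp only [hscale, Pi.one_apply]
      field_simp
  have := hbound.comp_tendsto (tendsto_inv₀_cobounded' (α := ℂ))
  rw [← Metric.cobounded_eq_cocompact]
  simpa only [Function.comp_def, inv_inv] using! this
end

section
/- Let X be a complex Banach space, m ≥ 0 an integer, and F : ℂ × X → ℂ an analytic function which is posthomogeneous of degree m, i.e. F(ζ, λy) = λ^m F(ζ, y) for all λ, ζ ∈ ℂ and y ∈ X. Then the following are equivalent: (i) for every (ζ, y) ∈ ℂ × X one has F(ζ/λ, λ²y) = O(λ²) as ℂ∖{0} ∋ λ → 0; (ii) for every y ∈ X the entire function ζ ↦ F(ζ, y) is a polynomial of degree at most 2m − 2 (in particular F = 0 when m = 0). -/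
open Asymptotics Filter

open Bornology in
/-- An entire function which is `o(z ^ n)` at infinity is a polynomial of degree less than `n`. -/
theorem Differentiable.exists_eq_sum_range_of_isLittleO_pow {g : ℂ → ℂ} {n : ℕ}
    (hg : Differentiable ℂ g) (h : g =o[cobounded ℂ] fun z => z ^ n) :
    ∃ c : ℕ → ℂ, ∀ z, g z = ∑ i ∈ Finset.range n, c i * z ^ i := by
  induction n generalizing g with
  | zero =>
    refine ⟨0, fun z => ?_⟩
    have h0 : Tendsto g (cocompact ℂ) (nhds 0) := by
      rw [← Metric.cobounded_eq_cocompact]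
      simpa only [pow_zero, isLittleO_one_iff] using h
    simpa using hg.apply_eq_of_tendsto_cocompact z h0
  | succ n ih =>
    have hd : Differentiable ℂ (dslope g 0) := by
      rw [← differentiableOn_univ] at hg ⊢
      exact (Complex.differentiableOn_dslope univ_mem).2 hg
    have hne : ∀ᶠ z : ℂ in cobounded ℂ, z ≠ 0 := eventually_ne_cobounded 0
    have hconst : (fun _ : ℂ => g 0) =o[cobounded ℂ] fun z : ℂ => z ^ (n + 1) := by
      simpa using (isLittleO_pow_pow_cobounded_of_lt (R := ℂ) n.succ_pos).const_mul_left (g 0)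
    have hslope : dslope g 0 =o[cobounded ℂ] fun z => z ^ n := by
      refine ((isBigO_refl (fun z : ℂ => z⁻¹) _).mul_isLittleO (h.sub hconst)).congr' ?_ ?_
      · filter_upwards [hne] with z hz
        simp [dslope_of_ne _ hz, slope_def_field, div_eq_inv_mul]
      · filter_upwards [hne] with z hz
        rw [pow_succ', inv_mul_cancel_left₀ hz]
    obtain ⟨c, hc⟩ := ih hd hslope
    refine ⟨fun i => Nat.casesOn i (g 0) c, fun z => ?_⟩
    have key := sub_smul_dslope g 0 z
    rw [sub_zero, smul_eq_mul, hc, Finset.mul_sum] at key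
    rw [Finset.sum_range_succ', ← sub_eq_iff_eq_add]
    simp only [pow_zero, mul_one]
    refine key.symm.trans ?_
    exact Finset.sum_congr rfl fun i _ => by ring

/-- Proposition 1.4: for an analytic function `F : ℂ × X → ℂ` on a complex Banach
space which is posthomogeneous of degree `m`, the growth condition
`F(ζ/λ, λ²y) = O(λ²)` as `λ → 0` holds iff `ζ ↦ F(ζ, y)` is a polynomial of degree
at most `2m − 2` for every `y` (in particular `F = 0` when `m = 0`). -/
theorem posthomogeneous_growth_iff_polynomial
    (X : Type*) [NormedAddCommGroup X] [NormedSpace ℂ X] [CompleteSpace X]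
    (m : ℕ)
    (F : ℂ × X → ℂ)
    (hF : ∀ p, AnalyticAt ℂ F p)
    (hhom : ∀ (lam ζ : ℂ) (y : X), F (ζ, lam • y) = lam ^ m * F (ζ, y)) :
    (∀ (ζ : ℂ) (y : X),
        (fun lam : ℂ => F (ζ / lam, lam ^ 2 • y)) =O[nhdsWithin 0 {(0 : ℂ)}ᶜ]
          (fun lam : ℂ => lam ^ 2)) ↔
    (∀ y : X, ∃ c : ℕ → ℂ, ∀ ζ : ℂ,
        F (ζ, y) = ∑ ν ∈ Finset.range (2 * m - 1), c ν * ζ ^ ν) := by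
  constructor
  · intro h y
    have hdiff : Differentiable ℂ fun ζ => F (ζ, y) := fun ζ =>
      (hF (ζ, y)).differentiableAt.comp ζ (by fun_prop)
    have hne : ∀ᶠ z : ℂ in Bornology.cobounded ℂ, z ≠ 0 := Bornology.eventually_ne_cobounded 0
    have hinv := (h 1 y).comp_tendsto tendsto_inv₀_cobounded'
    have hbig : (fun z => F (z, y)) =O[Bornology.cobounded ℂ]
        fun z : ℂ => z ^ (2 * m) * z⁻¹ ^ 2 := by
      refine ((isBigO_refl (fun z : ℂ => z ^ (2 * m)) _).mul hinv).congr' ?_ .rfl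
      filter_upwards [hne] with z hz
      simp only [Function.comp_apply, hhom, one_div, inv_inv]
      rw [← pow_mul, ← mul_assoc, ← mul_pow, mul_inv_cancel₀ hz, one_pow, one_mul]
    refine hdiff.exists_eq_sum_range_of_isLittleO_pow (hbig.trans_isLittleO ?_)
    cases m with
    | zero =>
      simpa [isLittleO_one_iff] using (tendsto_inv₀_cobounded (α := ℂ)).pow 2
    | succ k =>
      have hlt : 2 * k < 2 * (k + 1) - 1 := by omega
      refine (isLittleO_pow_pow_cobounded_of_lt (R := ℂ) hlt).congr' ?_ .rfl
      filter_upwards [hne] with z hz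
      field_simp
      ring
  · intro h ζ y
    obtain ⟨c, hc⟩ := h y
    simp only [hhom, hc, Finset.mul_sum]
    refine IsBigO.fun_sum fun ν hν => ?_
    have hν' : ν + 2 ≤ 2 * m := by
      have := Finset.mem_range.1 hν
      omega
    obtain ⟨d, hd⟩ := Nat.exists_eq_add_of_le hν'
    have hcont : Tendsto (fun lam : ℂ => c ν * ζ ^ ν * lam ^ d) (nhdsWithin 0 {(0 : ℂ)}ᶜ)
        (nhds (c ν * ζ ^ ν * 0 ^ d)) :=
      (Continuous.tendsto (by fun_prop) 0).mono_left nhdsWithin_le_nhds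
    refine ((hcont.isBigO_one ℂ).mul (isBigO_refl (fun lam : ℂ => lam ^ 2) _)).congr' ?_ ?_
    · filter_upwards [self_mem_nhdsWithin] with lam hlam
      have hlam' : lam ≠ 0 := hlam
      rw [← pow_mul, hd, div_pow]
      field_simp
      ring
    · exact .of_forall fun lam => one_mul _
end

section
/- Let 1 ≤ p < ∞, let m ≥ 2 be an integer, let C ≥ 0, and let Ψ : C(S¹,ℂ) → ℂ be a linear map such that |Ψ(x^m)| ≤ C (∫_{S¹} |x|^p)^{m/p} for every x ∈ C(S¹,ℂ), where x^m denotes the pointwise m-th power. Then |Ψ(z)| ≤ 2C (∫_{S¹} |z|^{p/m})^{m/p} for every z ∈ C(S¹,ℂ). -/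
open MeasureTheory

/-- A continuous complex function on the line has a continuous `n`-th root. -/
theorem exists_continuous_pow_eq_of_real {g : ℝ → ℂ} (hg : Continuous g) {n : ℕ} (hn : n ≠ 0) :
    ∃ f : ℝ → ℂ, Continuous f ∧ ∀ x, f x ^ n = g x := by
  set U : Set ℝ := {x | g x ≠ 0} with hU
  have hUo : IsOpen U := isOpen_ne_fun hg continuous_const
  have key (K : Set ℝ) (hK : IsOpen K ∧ Convex ℝ K ∧ K.Nonempty ∧ K ⊆ U) :
      ∃ f : ℝ → ℂ, ContinuousOn f K ∧ ∀ x, f x ^ n = g x := by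
    obtain ⟨hKo, hKc, hKn, hKU⟩ := hK
    have := hKc.contractibleSpace hKn
    have hKs : IsSimplyConnected K := .ofContractible K
    refine Complex.exists_continuousOn_pow_eq hKs hKo hg.continuousOn ?_ hn
    rintro ⟨x, hx, h0⟩
    exact hKU hx h0
  choose! r hrc hr using key
  have hcomp {x : ℝ} (hx : x ∈ U) :=
    (⟨hUo.connectedComponentIn, isPreconnected_connectedComponentIn.ordConnected.convex,
      ⟨x, mem_connectedComponentIn hx⟩, connectedComponentIn_subset U x⟩ :
      IsOpen (connectedComponentIn U x) ∧ Convex ℝ (connectedComponentIn U x) ∧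
      (connectedComponentIn U x).Nonempty ∧ connectedComponentIn U x ⊆ U)
  classical
  let f : ℝ → ℂ := fun x ↦ if x ∈ U then r (connectedComponentIn U x) x else 0
  have hf (x : ℝ) : f x ^ n = g x := by
    by_cases hx : x ∈ U
    · simpa [f, hx] using hr _ (hcomp hx) x
    · have : g x = 0 := by simpa [hU] using hx
      simp [f, hx, this, hn]
  refine ⟨f, continuous_iff_continuousAt.2 fun x ↦ ?_, hf⟩
  by_cases hx : x ∈ U
  · have hmem : connectedComponentIn U x ∈ nhds x :=
      (hcomp hx).1.mem_nhds (mem_connectedComponentIn hx)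
    refine ((hrc _ (hcomp hx)).continuousAt hmem).congr ?_
    filter_upwards [hmem] with y hy
    simp [f, connectedComponentIn_subset U x hy, connectedComponentIn_eq hy]
  · have hgx : g x = 0 := by simpa [hU] using hx
    have hfx : f x = 0 := by simp [f, hx]
    have hnorm (y : ℝ) : ‖f y‖ = ‖g y‖ ^ ((n : ℝ)⁻¹) := by
      rw [← hf y, norm_pow, Real.pow_rpow_inv_natCast (norm_nonneg _) hn]
    rw [ContinuousAt, hfx, tendsto_zero_iff_norm_tendsto_zero]
    simp only [hnorm]
    have h := (hg.norm.rpow_const (p := (n : ℝ)⁻¹) fun _ ↦ Or.inr (by positivity)).tendsto x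
    simpa [hgx, hn] using h

/-- A continuous complex function on a circle that vanishes somewhere has a continuous
`n`-th root. -/
theorem AddCircle.exists_pow_eq_of_apply_eq_zero {T : ℝ} [Fact (0 < T)] (z : C(AddCircle T, ℂ))
    {c : AddCircle T} (hc : z c = 0) {n : ℕ} (hn : n ≠ 0) :
    ∃ x : C(AddCircle T, ℂ), x ^ n = z := by
  obtain ⟨a, rfl⟩ := QuotientAddGroup.mk_surjective c
  obtain ⟨f, hfc, hf⟩ := exists_continuous_pow_eq_of_real
    (g := fun t : ℝ ↦ z (t : AddCircle T)) (z.continuous.comp (AddCircle.continuous_mk' T)) hn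
  have h₁ : f a = 0 := by
    rw [← pow_eq_zero_iff hn, hf]; exact hc
  have h₂ : f (a + T) = 0 := by
    rw [← pow_eq_zero_iff hn, hf, AddCircle.coe_add_period]; exact hc
  refine ⟨⟨AddCircle.liftIco T a f,
    AddCircle.liftIco_continuous (h₁.trans h₂.symm) hfc.continuousOn⟩, ?_⟩
  ext t
  obtain ⟨s, rfl⟩ : ∃ s : Set.Ico a (a + T), (s : AddCircle T) = t :=
    ⟨AddCircle.equivIco T a t, AddCircle.coe_equivIco⟩
  simp only [ContinuousMap.pow_apply, ContinuousMap.coe_mk, AddCircle.liftIco_coe_apply s.2, hf]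

/-- The quantitative core of Lemma 2.3: a linear functional on `C(S¹, ℂ)` bounded
on `m`-th powers in terms of the `L^p` norm is bounded in the `L^{p/m}` (quasi-)norm. -/
theorem functional_bounded_on_powers_extends
    (p : ℝ) (hp : 1 ≤ p)
    (m : ℕ) (hm : 2 ≤ m)
    (C : ℝ) (hC : 0 ≤ C)
    (Ψ : C(AddCircle (1 : ℝ), ℂ) →ₗ[ℂ] ℂ)
    (hΨ : ∀ x : C(AddCircle (1 : ℝ), ℂ),
      ‖Ψ (x ^ m)‖ ≤ C * (∫ t : AddCircle (1 : ℝ), ‖x t‖ ^ p) ^ ((m : ℝ) / p)) :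
    ∀ z : C(AddCircle (1 : ℝ), ℂ),
      ‖Ψ z‖ ≤ 2 * C * (∫ t : AddCircle (1 : ℝ), ‖z t‖ ^ (p / m)) ^ ((m : ℝ) / p) := by
  intro z
  have hm0 : m ≠ 0 := by lia
  have hq : 0 ≤ p / m := by positivity
  have bound (w : C(AddCircle (1 : ℝ), ℂ)) (c : AddCircle (1 : ℝ)) (hc : w c = 0)
      (hw : ∀ t, ‖w t‖ ≤ ‖z t‖) :
      ‖Ψ w‖ ≤ C * (∫ t : AddCircle (1 : ℝ), ‖z t‖ ^ (p / m)) ^ ((m : ℝ) / p) := by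
    obtain ⟨x, rfl⟩ := AddCircle.exists_pow_eq_of_apply_eq_zero w hc hm0
    refine (hΨ x).trans ?_
    have hint (y : C(AddCircle (1 : ℝ), ℂ)) {q : ℝ} (hq : 0 ≤ q) :
        Integrable (fun t ↦ ‖y t‖ ^ q) :=
      (y.continuous.norm.rpow_const fun _ ↦ Or.inr hq).integrable_of_hasCompactSupport
        (HasCompactSupport.of_compactSpace _)
    gcongr ?_ * ?_ ^ _
    refine integral_mono (hint x (by positivity)) (hint z hq) fun t ↦ ?_
    calc ‖x t‖ ^ p = ‖(x ^ m) t‖ ^ (p / m) := by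
            rw [ContinuousMap.pow_apply, norm_pow, ← Real.rpow_natCast_mul (norm_nonneg _),
              mul_div_cancel₀ _ (by positivity)]
        _ ≤ ‖z t‖ ^ (p / m) := by gcongr; exact hw t
  obtain ⟨a, b, hab⟩ : ∃ a b : AddCircle (1 : ℝ), a ≠ b := by
    refine ⟨((1 / 2 : ℝ) : AddCircle (1 : ℝ)), 0, fun h ↦ ?_⟩
    have := AddCircle.norm_half_period_eq (1 : ℝ)
    norm_num [h] at this
  obtain ⟨φ, hφa, hφb, hφ⟩ := exists_continuous_zero_one_of_isClosed (isClosed_singleton (x := a))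
    (isClosed_singleton (x := b)) (by simpa using hab)
  let ψ : C(AddCircle (1 : ℝ), ℂ) := ⟨fun t ↦ (φ t : ℂ), by fun_prop⟩
  have ha : φ a = 0 := hφa rfl
  have hb : φ b = 1 := hφb rfl
  have hsplit : z = z * ψ + z * (1 - ψ) := by ring
  have h₁ := bound (z * ψ) a (by simp [ψ, ha]) fun t ↦ by
    simpa [ψ, abs_of_nonneg (hφ t).1] using
      mul_le_of_le_one_right (norm_nonneg (z t)) (hφ t).2
  have h₂ := bound (z * (1 - ψ)) b (by simp [ψ, hb]) fun t ↦ by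
    have h : ‖(1 - ψ) t‖ ≤ 1 := by
      change ‖(1 : ℂ) - (φ t : ℂ)‖ ≤ 1
      rw [← Complex.ofReal_one, ← Complex.ofReal_sub, Complex.norm_real, Real.norm_eq_abs, abs_le]
      constructor <;> linarith [(hφ t).1, (hφ t).2]
    simpa using mul_le_of_le_one_right (norm_nonneg (z t)) h
  calc ‖Ψ z‖ = ‖Ψ (z * ψ) + Ψ (z * (1 - ψ))‖ := by rw [← map_add, ← hsplit]
    _ ≤ ‖Ψ (z * ψ)‖ + ‖Ψ (z * (1 - ψ))‖ := norm_add_le _ _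
    _ ≤ _ := by linarith
end

section
/- Let 1 ≤ p < ∞ and let m ≥ 2 be an integer with p < m. If Ψ : C(S¹,ℂ) → ℂ is a linear map and C ≥ 0 is such that |Ψ(x^m)| ≤ C (∫_{S¹} |x|^p)^{m/p} for every x ∈ C(S¹,ℂ) (x^m being the pointwise m-th power), then Ψ = 0. -/
open MeasureTheory

theorem AddCircle.exists_natCast_div_dist_lt {n : ℕ} (hn : 0 < n) (t : AddCircle (1 : ℝ)) :
    ∃ i : Fin n, dist t (((i : ℕ) / n : ℝ) : AddCircle (1 : ℝ)) < 1 / n := by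
  have hn' : (0 : ℝ) < n := by exact_mod_cast hn
  obtain ⟨x, ⟨hx0, hx1⟩, rfl⟩ : ∃ x ∈ Set.Ico (0 : ℝ) (0 + 1), (x : AddCircle (1 : ℝ)) = t := by
    have h : t ∈ ((↑) : ℝ → AddCircle (1 : ℝ)) '' Set.Ico (0 : ℝ) (0 + 1) := by
      rw [AddCircle.coe_image_Ico_eq]; trivial
    exact h
  have hnx : 0 ≤ n * x := by positivity
  have hlt : ⌊n * x⌋₊ < n := (Nat.floor_lt hnx).2 (by nlinarith)
  refine ⟨⟨⌊n * x⌋₊, hlt⟩, ?_⟩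
  have h1 := Nat.floor_le hnx
  have h2 := Nat.lt_floor_add_one (n * x)
  rw [dist_eq_norm, ← AddCircle.coe_sub]
  refine lt_of_le_of_lt (QuotientAddGroup.norm_mk_le_norm) ?_
  rw [Real.norm_eq_abs, abs_lt]
  have h3 : x - (⌊n * x⌋₊ : ℝ) / n = (n * x - ⌊n * x⌋₊) / n := by field_simp
  rw [h3]
  constructor
  · have : 0 ≤ (n * x - ⌊n * x⌋₊) / n := div_nonneg (by linarith) hn'.le
    have : 0 < 1 / (n : ℝ) := by positivity
    linarith
  · gcongr
    linarith

theorem AddCircle.integral_norm_rpow_le_of_eq_zero_off_closedBall {p : ℝ} (hp : 0 < p) {B r : ℝ}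
    (hr : 0 ≤ r) (c : AddCircle (1 : ℝ)) (x : C(AddCircle (1 : ℝ), ℂ))
    (hB : ∀ t, ‖x t‖ ≤ B) (hx : ∀ t ∉ Metric.closedBall c r, x t = 0) :
    ∫ t, ‖x t‖ ^ p ≤ B ^ p * (2 * r) := by
  have hB0 : 0 ≤ B := (norm_nonneg _).trans (hB c)
  rw [← setIntegral_eq_integral_of_forall_compl_eq_zero (s := Metric.closedBall c r)
    (fun t ht => by rw [hx t ht, norm_zero, Real.zero_rpow hp.ne'])]
  refine (le_abs_self _).trans ?_
  rw [← Real.norm_eq_abs]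
  refine (norm_setIntegral_le_of_norm_le_const (C := B ^ p) (measure_lt_top _ _)
    (fun t _ => ?_)).trans ?_
  · rw [Real.norm_of_nonneg (by positivity)]
    exact Real.rpow_le_rpow (norm_nonneg _) (hB t) hp.le
  · gcongr
    rw [measureReal_def, AddCircle.volume_closedBall]
    exact ENNReal.toReal_le_of_le_ofReal (by positivity)
      (ENNReal.ofReal_le_ofReal (min_le_right _ _))

theorem AddCircle.exists_partition_subordinate_closedBall {n : ℕ} (hn : 0 < n) :
    ∃ φ : Fin n → C(AddCircle (1 : ℝ), ℝ), (∀ i t, 0 ≤ φ i t) ∧ (∀ i t, φ i t ≤ 1) ∧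
      (∀ t, ∑ i, φ i t = 1) ∧
      ∀ i : Fin n, ∀ t ∉ Metric.closedBall (((i : ℕ) / n : ℝ) : AddCircle (1 : ℝ)) (1 / n), φ i t = 0 := by
  obtain ⟨ρ, hρ⟩ := PartitionOfUnity.exists_isSubordinate (isClosed_univ)
    (fun i : Fin n => Metric.ball (((i : ℕ) / n : ℝ) : AddCircle (1 : ℝ)) (1 / n))
    (fun i => Metric.isOpen_ball)
    (fun t _ => Set.mem_iUnion.2 (AddCircle.exists_natCast_div_dist_lt hn t))
  refine ⟨fun i => ρ i, fun i t => ρ.nonneg i t, fun i t => ρ.le_one i t, fun t => ?_,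
    fun i t ht => ?_⟩
  · rw [← finsum_eq_sum_of_fintype]
    exact ρ.sum_eq_one (Set.mem_univ t)
  · by_contra h
    exact ht (Metric.ball_subset_closedBall (hρ i (subset_tsupport _ h)))

/-- A nonnegative continuous function, viewed as complex-valued, is an `m`-th power. -/
theorem ContinuousMap.exists_pow_eq_ofReal {X : Type*} [TopologicalSpace X] {m : ℕ} (hm : m ≠ 0)
    (f : C(X, ℝ)) (hf : ∀ t, 0 ≤ f t) :
    ∃ x : C(X, ℂ), (∀ t, (x ^ m) t = (f t : ℂ)) ∧ ∀ t, ‖x t‖ = f t ^ (1 / (m : ℝ)) := by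
  refine ⟨⟨fun t => ((f t ^ (1 / (m : ℝ)) : ℝ) : ℂ), Complex.continuous_ofReal.comp
    (f.continuous.rpow_const fun _ => Or.inr (by positivity))⟩, fun t => ?_, fun t => ?_⟩
  · change (((f t ^ (1 / (m : ℝ)) : ℝ) : ℂ)) ^ m = _
    rw [← Complex.ofReal_pow, one_div, Real.rpow_inv_natCast_pow (hf t) hm]
  · change ‖((f t ^ (1 / (m : ℝ)) : ℝ) : ℂ)‖ = _
    rw [Complex.norm_real, Real.norm_of_nonneg (Real.rpow_nonneg (hf t) _)]

theorem tendsto_natCast_mul_const_div_rpow {r : ℝ} (hr : 1 < r) {C K : ℝ} (hK : 0 ≤ K) :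
    Filter.Tendsto (fun n : ℕ => n * (C * (K * (2 * (1 / n))) ^ r)) Filter.atTop (nhds 0) := by
  have h : Filter.Tendsto (fun n : ℕ => C * (2 * K) ^ r * (n : ℝ) ^ (-(r - 1)))
      Filter.atTop (nhds (C * (2 * K) ^ r * 0)) :=
    ((tendsto_rpow_neg_atTop (by linarith)).comp tendsto_natCast_atTop_atTop).const_mul _
  rw [mul_zero] at h
  refine h.congr' ?_
  filter_upwards [Filter.eventually_gt_atTop 0] with n hn
  have hn' : (0 : ℝ) < n := by exact_mod_cast hn
  rw [show K * (2 * (1 / (n : ℝ))) = 2 * K / n by ring, Real.div_rpow (by positivity) hn'.le,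
    neg_sub, Real.rpow_sub hn', Real.rpow_one]
  ring

theorem functional_eq_zero_of_nonneg {p : ℝ} (hp : 0 < p) {m : ℕ} (hpm : p < m) {C : ℝ}
    (hC : 0 ≤ C) (Ψ : C(AddCircle (1 : ℝ), ℂ) →ₗ[ℂ] ℂ)
    (hΨ : ∀ x : C(AddCircle (1 : ℝ), ℂ),
      ‖Ψ (x ^ m)‖ ≤ C * (∫ t : AddCircle (1 : ℝ), ‖x t‖ ^ p) ^ ((m : ℝ) / p))
    (y : C(AddCircle (1 : ℝ), ℂ)) (f : C(AddCircle (1 : ℝ), ℝ)) (hf : ∀ t, 0 ≤ f t)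
    (hy : ∀ t, y t = f t) : Ψ y = 0 := by
  have hm : (0 : ℝ) < m := hp.trans hpm
  have hm0 : m ≠ 0 := by exact_mod_cast hm.ne'
  set B : ℝ := ‖f‖ ^ (1 / (m : ℝ))
  have key : ∀ n : ℕ, 0 < n → ‖Ψ y‖ ≤ n * (C * (B ^ p * (2 * (1 / n))) ^ ((m : ℝ) / p)) := by
    intro n hn
    obtain ⟨φ, hφ0, hφ1, hφs, hφb⟩ := AddCircle.exists_partition_subordinate_closedBall hn
    have hfφ : ∀ i t, 0 ≤ (f * φ i) t := fun i t => mul_nonneg (hf t) (hφ0 i t)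
    choose x hx hxn using fun i => ContinuousMap.exists_pow_eq_ofReal hm0 (f * φ i) (hfφ i)
    have hsum : y = ∑ i, x i ^ m := by
      ext t
      rw [ContinuousMap.sum_apply, Finset.sum_congr rfl fun i _ => hx i t, hy,
        ← Complex.ofReal_sum]
      simp only [ContinuousMap.mul_apply]
      rw [← Finset.mul_sum, hφs, mul_one]
    have hterm : ∀ i, ‖Ψ (x i ^ m)‖ ≤ C * (B ^ p * (2 * (1 / n))) ^ ((m : ℝ) / p) := by
      intro i
      refine (hΨ _).trans ?_
      gcongr
      refine AddCircle.integral_norm_rpow_le_of_eq_zero_off_closedBall hp (by positivity)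
        (((i : ℕ) / n : ℝ) : AddCircle (1 : ℝ)) _ (fun t => ?_) (fun t ht => ?_)
      · rw [hxn]
        refine Real.rpow_le_rpow (hfφ i t) ?_ (by positivity)
        exact (mul_le_of_le_one_right (hf t) (hφ1 i t)).trans
          ((le_abs_self _).trans (f.norm_coe_le_norm t))
      · rw [← norm_eq_zero, hxn, ContinuousMap.mul_apply, hφb i t ht, mul_zero,
          Real.zero_rpow (by positivity)]
    rw [hsum, map_sum]
    refine (norm_sum_le _ _).trans ((Finset.sum_le_card_nsmul _ _ _ fun i _ => hterm i).trans ?_)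
    simp
  have hlim := tendsto_natCast_mul_const_div_rpow (C := C) ((one_lt_div hp).2 hpm)
    (show 0 ≤ B ^ p by positivity)
  refine norm_le_zero_iff.1 (ge_of_tendsto hlim ?_)
  filter_upwards [Filter.eventually_gt_atTop 0] with n hn using key n hn

/-- Every continuous complex function is a combination of four nonnegative ones. -/
theorem ContinuousMap.linearMap_eq_zero_of_nonneg {X : Type*} [TopologicalSpace X]
    (Ψ : C(X, ℂ) →ₗ[ℂ] ℂ)
    (h : ∀ (y : C(X, ℂ)) (f : C(X, ℝ)), (∀ t, 0 ≤ f t) → (∀ t, y t = f t) → Ψ y = 0) :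
    Ψ = 0 := by
  let e : C(X, ℝ) → C(X, ℂ) := fun f => ⟨fun t => (f t : ℂ), by fun_prop⟩
  have hreal : ∀ f, Ψ (e f) = 0 := by
    intro f
    have hf : e f = e (f ⊔ 0) - e (-f ⊔ 0) := by
      ext t
      change (f t : ℂ) = ((f t ⊔ 0 : ℝ) : ℂ) - ((-f t ⊔ 0 : ℝ) : ℂ)
      rw [← Complex.ofReal_sub, max_zero_sub_max_neg_zero_eq_self]
    rw [hf, map_sub, h _ (f ⊔ 0) (fun _ => le_sup_right) fun _ => rfl,
      h _ (-f ⊔ 0) (fun _ => le_sup_right) fun _ => rfl, sub_zero]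
  ext y
  have hy : y = e ⟨fun t => (y t).re, by fun_prop⟩
      + Complex.I • e ⟨fun t => (y t).im, by fun_prop⟩ := by
    ext t
    change y t = ((y t).re : ℂ) + Complex.I * ((y t).im : ℂ)
    rw [mul_comm, Complex.re_add_im]
  rw [hy, map_add, map_smul, hreal, hreal]
  simp

/-- The vanishing alternative in Lemma 2.3 (via Day's theorem): if `m > p`, a linear
functional on `C(S¹, ℂ)` bounded on `m`-th powers in the `L^p` norm vanishes. -/
theorem functional_bounded_on_powers_vanishes
    (p : ℝ) (hp : 1 ≤ p)
    (m : ℕ) (hm : 2 ≤ m) (hpm : p < m)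
    (C : ℝ) (hC : 0 ≤ C)
    (Ψ : C(AddCircle (1 : ℝ), ℂ) →ₗ[ℂ] ℂ)
    (hΨ : ∀ x : C(AddCircle (1 : ℝ), ℂ),
      ‖Ψ (x ^ m)‖ ≤ C * (∫ t : AddCircle (1 : ℝ), ‖x t‖ ^ p) ^ ((m : ℝ) / p)) :
    Ψ = 0 :=
  ContinuousMap.linearMap_eq_zero_of_nonneg Ψ
    (functional_eq_zero_of_nonneg (by linarith) hpm hC Ψ hΨ)
end

section
/- Let 1 ≤ p < ∞ and let m ≥ 2 be an integer with m > p. If ℰ is a continuous symmetric m-multilinear form on L^p(S¹,ℂ) such that E(x) = ℰ(x,…,x) satisfies E(x+y) = E(x) + E(y) whenever x·y = 0 almost everywhere, then ℰ = 0. -/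
open MeasureTheory

/-- A real-valued map with null level sets cuts the integral of any integrable function into two
equal halves. -/
lemma exists_setIntegral_eq_half {α : Type*} [MeasurableSpace α] {μ : Measure α} {φ : α → ℝ}
    (hφ : Measurable φ) (hnull : ∀ t, μ (φ ⁻¹' {t}) = 0) (hφ_mem : ∀ x, φ x ∈ Set.Ioc 0 1)
    {h : α → ℝ} (hint : Integrable h μ) :
    ∃ S, MeasurableSet S ∧ ∫ x in S, h x ∂μ = (∫ x, h x ∂μ) / 2 := by
  have hS : ∀ t, MeasurableSet (φ ⁻¹' Set.Iic t) := fun t => hφ measurableSet_Iic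
  have hcont : Continuous fun t => ∫ x, (φ ⁻¹' Set.Iic t).indicator h x ∂μ := by
    rw [continuous_iff_continuousAt]
    intro t
    refine continuousAt_of_dominated (bound := fun x => ‖h x‖)
      (.of_forall fun s => (hint.indicator (hS s)).aestronglyMeasurable)
      (.of_forall fun s => .of_forall fun x => norm_indicator_le_norm_self h x) hint.norm ?_
    have hne : ∀ᵐ x ∂μ, φ x ≠ t :=
      measure_eq_zero_iff_ae_notMem.mp (hnull t)
    filter_upwards [hne] with x hx
    rcases lt_or_gt_of_ne hx with hx | hx
    · refine (continuousAt_const (y := h x)).congr ?_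
      filter_upwards [lt_mem_nhds hx] with s hs
      simp [Set.indicator, hs.le]
    · refine (continuousAt_const (y := (0 : ℝ))).congr ?_
      filter_upwards [gt_mem_nhds hx] with s hs
      simp [Set.indicator, hs]
  have h0 : φ ⁻¹' Set.Iic 0 = ∅ := by
    ext x
    simpa using (hφ_mem x).1
  have h1 : φ ⁻¹' Set.Iic 1 = Set.univ := by
    ext x
    simpa using (hφ_mem x).2
  have hmem : (∫ x, h x ∂μ) / 2 ∈
      Set.uIcc (∫ x, (φ ⁻¹' Set.Iic (0 : ℝ)).indicator h x ∂μ)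
        (∫ x, (φ ⁻¹' Set.Iic (1 : ℝ)).indicator h x ∂μ) := by
    simp only [h0, h1, Set.indicator_empty, Set.indicator_univ, integral_zero, Set.mem_uIcc]
    rcases le_total 0 (∫ x, h x ∂μ) with hle | hle
    · left; constructor <;> linarith
    · right; constructor <;> linarith
  obtain ⟨t, -, ht⟩ := intermediate_value_uIcc hcont.continuousOn hmem
  exact ⟨_, hS t, (integral_indicator (hS t)).symm.trans ht⟩

lemma Lp_norm_rpow_eq_integral {α F : Type*} [MeasurableSpace α] [NormedAddCommGroup F]
    {μ : Measure α} {p : ℝ} (hp : 0 < p) (f : Lp F (ENNReal.ofReal p) μ) :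
    ‖f‖ ^ p = ∫ x, ‖f x‖ ^ p ∂μ := by
  rw [Lp.norm_def, toReal_eLpNorm (Lp.aestronglyMeasurable f),
    lpNorm_eq_integral_norm_rpow_toReal (by simpa using hp) ENNReal.ofReal_ne_top
      (Lp.aestronglyMeasurable f), ENNReal.toReal_ofReal hp.le, Real.rpow_inv_rpow _ hp.ne']
  positivity

/-- Every `f` in `L^p` of the circle splits into two disjointly supported pieces of equal norm. -/
lemma AddCircle.exists_disjoint_add_eq_of_Lp {F : Type*} [NormedRing F] {p : ℝ} (hp : 0 < p)
    [Fact ((1 : ENNReal) ≤ ENNReal.ofReal p)]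
    (f : Lp F (ENNReal.ofReal p) (volume : Measure (AddCircle (1 : ℝ)))) :
    ∃ g₁ g₂ : Lp F (ENNReal.ofReal p) (volume : Measure (AddCircle (1 : ℝ))),
      f = g₁ + g₂ ∧ (∀ᵐ t, g₁ t * g₂ t = 0) ∧
      ‖g₁‖ = (1 / 2 : ℝ) ^ p⁻¹ * ‖f‖ ∧ ‖g₂‖ = (1 / 2 : ℝ) ^ p⁻¹ * ‖f‖ := by
  have hint : Integrable (fun t => ‖f t‖ ^ p) (volume : Measure (AddCircle (1 : ℝ))) := by
    simpa [ENNReal.toReal_ofReal hp.le] using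
      (Lp.memLp f).integrable_norm_rpow (by simpa using hp) ENNReal.ofReal_ne_top
  have : NullSingletonClass (volume : Measure (AddCircle (1 : ℝ))) :=
    ⟨fun x => by simpa using AddCircle.volume_closedBall 1 (x := x) 0⟩
  have hφ_inj : Function.Injective fun t : AddCircle (1 : ℝ) =>
      (AddCircle.measurableEquivIoc 1 0 t : ℝ) :=
    Subtype.val_injective.comp (AddCircle.measurableEquivIoc 1 0).injective
  obtain ⟨S, hS, hSint⟩ := exists_setIntegral_eq_half
    (φ := fun t => (AddCircle.measurableEquivIoc 1 0 t : ℝ))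
    (measurable_subtype_coe.comp (AddCircle.measurableEquivIoc 1 0).measurable)
    (fun t => (Set.subsingleton_singleton.preimage hφ_inj).measure_zero _)
    (fun x => by simpa using (AddCircle.measurableEquivIoc 1 0 x).2) hint
  have hSint' : ∫ x in Sᶜ, ‖f x‖ ^ p = (∫ x, ‖f x‖ ^ p) / 2 := by
    have := integral_add_compl hS hint
    linarith
  have key : ∀ T, MeasurableSet T → ∫ x in T, ‖f x‖ ^ p = (∫ x, ‖f x‖ ^ p) / 2 →
      ∀ g : Lp F (ENNReal.ofReal p) (volume : Measure (AddCircle (1 : ℝ))),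
      g =ᵐ[volume] T.indicator f → ‖g‖ = (1 / 2 : ℝ) ^ p⁻¹ * ‖f‖ := by
    intro T hT hTint g hg
    have hpow : ‖g‖ ^ p = 1 / 2 * ‖f‖ ^ p := by
      rw [Lp_norm_rpow_eq_integral hp, Lp_norm_rpow_eq_integral hp, one_div_mul_eq_div, ← hTint,
        ← integral_indicator hT]
      refine integral_congr_ae ?_
      filter_upwards [hg] with x hx
      rw [hx]
      by_cases hxT : x ∈ T <;> simp [hxT, hp.ne']
    rw [← Real.rpow_rpow_inv (norm_nonneg g) hp.ne', hpow,
      Real.mul_rpow (by norm_num) (by positivity), Real.rpow_rpow_inv (norm_nonneg f) hp.ne']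
  have hg₁ := ((Lp.memLp f).indicator hS).coeFn_toLp
  have hg₂ := ((Lp.memLp f).indicator hS.compl).coeFn_toLp
  refine ⟨_, _, ?_, ?_, key S hS hSint _ hg₁, key Sᶜ hS.compl hSint' _ hg₂⟩
  · refine Lp.ext ?_
    filter_upwards [hg₁, hg₂, Lp.coeFn_add ((Lp.memLp f).indicator hS).toLp
      ((Lp.memLp f).indicator hS.compl).toLp] with x h₁ h₂ h₃
    rw [h₃, Pi.add_apply, h₁, h₂, Set.indicator_self_add_compl_apply]
  · filter_upwards [hg₁, hg₂] with x h₁ h₂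
    rw [h₁, h₂]
    by_cases hx : x ∈ S <;> simp [hx]

/-- A symmetric continuous multilinear map vanishing on the diagonal is zero. -/
lemma ContinuousMultilinearMap.eq_zero_of_diagonal_eq_zero {V W : Type*}
    [NormedAddCommGroup V] [NormedSpace ℂ V] [NormedAddCommGroup W] [NormedSpace ℂ W] {m : ℕ}
    (f : ContinuousMultilinearMap ℂ (fun _ : Fin m => V) W)
    (hsymm : ∀ (σ : Equiv.Perm (Fin m)) (y : Fin m → V), f (fun j => y (σ j)) = f y)
    (hdiag : ∀ x, f (fun _ => x) = 0) : f = 0 := by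
  ext v
  have h := f.iteratedFDeriv_comp_diagonal 0 v
  simp only [hdiag, hsymm, Finset.sum_const, Finset.card_univ, Fintype.card_perm,
    Fintype.card_fin] at h
  have h' : (m.factorial : ℂ) • f v = 0 := by
    rw [Nat.cast_smul_eq_nsmul, ← h, iteratedFDeriv_fun_zero]
    rfl
  exact (smul_eq_zero.mp h').resolve_left (Nat.cast_ne_zero.mpr m.factorial_ne_zero)

/-- Lemma 2.4, vanishing case: an additive continuous symmetric `m`-multilinear form
on `L^p(S¹, ℂ)` with `m > p` vanishes identically. (The `Fact` instance records
`1 ≤ p` on the level of extended-real exponents; it follows from `hp`.) -/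
theorem additive_polynomial_on_Lp_vanishes
    (p : ℝ) (hp : 1 ≤ p)
    (m : ℕ) (hm : 2 ≤ m) (hpm : p < m)
    [Fact ((1 : ENNReal) ≤ ENNReal.ofReal p)]
    (ℰ : ContinuousMultilinearMap ℂ
      (fun _ : Fin m => Lp ℂ (ENNReal.ofReal p) (volume : Measure (AddCircle (1 : ℝ)))) ℂ)
    (hsymm : ∀ (σ : Equiv.Perm (Fin m))
      (y : Fin m → Lp ℂ (ENNReal.ofReal p) (volume : Measure (AddCircle (1 : ℝ)))),
      ℰ (fun j => y (σ j)) = ℰ y)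
    (E : Lp ℂ (ENNReal.ofReal p) (volume : Measure (AddCircle (1 : ℝ))) → ℂ)
    (hE : ∀ x, E x = ℰ (fun _ => x))
    (hadd : ∀ x y : Lp ℂ (ENNReal.ofReal p) (volume : Measure (AddCircle (1 : ℝ))),
      (∀ᵐ t : AddCircle (1 : ℝ), x t * y t = 0) → E (x + y) = E x + E y) :
    ℰ = 0 := by
  have hp0 : 0 < p := by linarith
  set c : ℝ := (1 / 2 : ℝ) ^ p⁻¹ with hc
  have hc0 : 0 ≤ c := by positivity
  have hcm : 2 * c ^ m < 1 := by
    have hlt : c ^ m < (1 / 2 : ℝ) ^ (1 : ℝ) := by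
      rw [hc, ← Real.rpow_mul_natCast (by norm_num)]
      refine Real.rpow_lt_rpow_of_exponent_gt (by norm_num) (by norm_num) ?_
      rwa [inv_mul_eq_div, one_lt_div hp0]
    rw [Real.rpow_one] at hlt
    linarith
  have hbound : ∀ (k : ℕ) x, ‖E x‖ ≤ (2 * c ^ m) ^ k * (‖ℰ‖ * ‖x‖ ^ m) := by
    intro k
    induction k with
    | zero =>
      intro x
      simpa [hE] using ℰ.le_opNorm fun _ => x
    | succ k ih =>
      intro x
      obtain ⟨g₁, g₂, hx, hdisj, hn₁, hn₂⟩ := AddCircle.exists_disjoint_add_eq_of_Lp hp0 x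
      calc ‖E x‖ ≤ ‖E g₁‖ + ‖E g₂‖ := by
            rw [hx, hadd g₁ g₂ hdisj]
            exact norm_add_le _ _
        _ ≤ (2 * c ^ m) ^ k * (‖ℰ‖ * ‖g₁‖ ^ m) + (2 * c ^ m) ^ k * (‖ℰ‖ * ‖g₂‖ ^ m) :=
            add_le_add (ih g₁) (ih g₂)
        _ = (2 * c ^ m) ^ (k + 1) * (‖ℰ‖ * ‖x‖ ^ m) := by
            rw [hn₁, hn₂]
            ring
  refine ℰ.eq_zero_of_diagonal_eq_zero hsymm fun x => ?_
  have hlim := (tendsto_pow_atTop_nhds_zero_of_lt_one (by positivity) hcm).mul_const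
    (‖ℰ‖ * ‖x‖ ^ m)
  rw [zero_mul] at hlim
  rw [← hE, ← norm_le_zero_iff]
  exact ge_of_tendsto' hlim fun k => hbound k x
end

section
/- Let E : C(S¹,ℂ) → ℂ be an analytic function (in the sense of analytic maps between complex Banach spaces) which is additive, i.e. E(x+y) = E(x) + E(y) whenever supp x ∩ supp y = ∅. Let N ≥ 3 and z₁,…,z_N ∈ C(S¹,ℂ), with indices taken modulo N (so z₀ = z_N). Assume that no point of S¹ lies in the support of more than two of the z_j, and that supp z_i ∩ supp z_j = ∅ whenever i and j are neither equal nor cyclically consecutive modulo N. Then E(Σ_{j=1}^N z_j) = Σ_{j=1}^N E(z_{j−1} + z_j) − Σ_{j=1}^N E(z_j). -/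
open MeasureTheory

section OrthogonallyAdditive

open Set Filter Topology

variable {X : Type*} [TopologicalSpace X]

theorem mul_eq_zero_of_tsupport_inter_eq_empty {x y : C(X, ℂ)}
    (h : tsupport x ∩ tsupport y = ∅) : x * y = 0 := by
  ext t
  by_contra hne
  have hne : x t * y t ≠ 0 := hne
  exact (h ▸ (⟨subset_tsupport _ (left_ne_zero_of_mul hne),
    subset_tsupport _ (right_ne_zero_of_mul hne)⟩ : t ∈ tsupport x ∩ tsupport y) : t ∈ (∅ : Set X))

theorem exists_add_eq_mul_eq_zero [NormalSpace X] {u v x : C(X, ℂ)}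
    (h : tsupport u ∩ tsupport v ∩ tsupport x = ∅) :
    ∃ a b : C(X, ℂ), a + b = x ∧ a * u = 0 ∧ b * v = 0 := by
  obtain ⟨φ, hφu, hφv, -⟩ := exists_continuous_zero_one_of_isClosed
    ((isClosed_tsupport x).inter (isClosed_tsupport u))
    ((isClosed_tsupport x).inter (isClosed_tsupport v))
    (disjoint_left.2 fun t hu hv => (h ▸ (⟨⟨hu.2, hv.2⟩, hu.1⟩ :
      t ∈ tsupport u ∩ tsupport v ∩ tsupport x) : t ∈ (∅ : Set X)))
  refine ⟨⟨fun t => x t * (φ t : ℂ), by fun_prop⟩, ⟨fun t => x t * (1 - φ t : ℂ), by fun_prop⟩,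
    ?_, ?_, ?_⟩ <;> ext t
  · simp only [ContinuousMap.add_apply, ContinuousMap.coe_mk]
    ring
  · by_cases hx : x t = 0
    · simp [hx]
    by_cases hu : u t = 0
    · simp [hu]
    have : φ t = 0 := hφu ⟨subset_tsupport _ hx, subset_tsupport _ hu⟩
    simp [this]
  · by_cases hx : x t = 0
    · simp [hx]
    by_cases hv : v t = 0
    · simp [hv]
    have : φ t = 1 := hφv ⟨subset_tsupport _ hx, subset_tsupport _ hv⟩
    simp [this]

variable [CompactSpace X]

/-- Every continuous function is a uniform limit of functions whose closed support is contained in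
its open support. -/
theorem exists_dist_le_tsupport_subset (x : C(X, ℂ)) {ε : ℝ} (hε : 0 < ε) :
    ∃ x' : C(X, ℂ), dist x' x ≤ ε ∧ tsupport x' ⊆ {t | x t ≠ 0} := by
  have hm : ∀ t, 0 < max ε ‖x t‖ := fun t => lt_max_of_lt_left hε
  let c : C(X, ℝ) := ⟨fun t => ε / max ε ‖x t‖,
    continuous_const.div (by fun_prop) fun t => (hm t).ne'⟩
  let x' : C(X, ℂ) := ⟨fun t => x t - x t * (c t : ℂ), by fun_prop⟩
  refine ⟨x', (ContinuousMap.dist_le hε.le).2 fun t => ?_, ?_⟩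
  · have hc : 0 ≤ c t := div_nonneg hε.le (hm t).le
    have hdist : dist (x' t) (x t) = ‖x t‖ * c t := by
      simp [x', abs_of_nonneg hc]
    rw [hdist]
    change ‖x t‖ * (ε / max ε ‖x t‖) ≤ ε
    rw [mul_div_assoc', div_le_iff₀ (hm t), mul_comm]
    exact mul_le_mul_of_nonneg_left (le_max_right _ _) hε.le
  · have hsub : tsupport x' ⊆ {t | ε ≤ ‖x t‖} := by
      refine closure_minimal (fun t ht => ?_) (isClosed_le (by fun_prop) (by fun_prop))
      by_contra hlt
      have hlt : ‖x t‖ < ε := not_le.1 hlt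
      refine ht ?_
      simp [x', c, max_eq_left hlt.le, hε.ne']
    intro t ht h0
    have := hsub ht
    rw [mem_ofPred_eq, h0, norm_zero] at this
    exact hε.not_ge this

theorem mem_closure_tsupport_inter_eq_empty {x y : C(X, ℂ)} (hxy : x * y = 0) :
    (x, y) ∈ closure {p : C(X, ℂ) × C(X, ℂ) | tsupport p.1 ∩ tsupport p.2 = ∅} := by
  refine Metric.mem_closure_iff.2 fun ε hε => ?_
  obtain ⟨x', hx', hxs⟩ := exists_dist_le_tsupport_subset x (half_pos hε)
  obtain ⟨y', hy', hys⟩ := exists_dist_le_tsupport_subset y (half_pos hε)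
  refine ⟨(x', y'), ?_, ?_⟩
  · refine eq_empty_of_forall_notMem fun t ht => ?_
    exact mul_ne_zero (hxs ht.1) (hys ht.2) (by simpa using DFunLike.congr_fun hxy t)
  · rw [Prod.dist_eq, dist_comm x, dist_comm y]
    exact (max_le hx' hy').trans_lt (half_lt_self hε)

variable {E : C(X, ℂ) → ℂ}

theorem map_add_of_mul_eq_zero (hE : Continuous E)
    (hadd : ∀ x y : C(X, ℂ), tsupport x ∩ tsupport y = ∅ → E (x + y) = E x + E y)
    {x y : C(X, ℂ)} (hxy : x * y = 0) : E (x + y) = E x + E y :=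
  closure_minimal (t := {p : C(X, ℂ) × C(X, ℂ) | E (p.1 + p.2) = E p.1 + E p.2})
    (fun p hp => hadd p.1 p.2 hp) (isClosed_eq (by fun_prop) (by fun_prop))
    (mem_closure_tsupport_inter_eq_empty hxy)

variable [NormalSpace X]

theorem map_add_add_of_tsupport_inter_eq_empty (hE : ∀ x, AnalyticAt ℂ E x)
    (hadd : ∀ x y : C(X, ℂ), x * y = 0 → E (x + y) = E x + E y)
    {x y : C(X, ℂ)} (hxy : tsupport x ∩ tsupport y = ∅) (w : C(X, ℂ)) :
    E (w + x + y) + E w = E (w + x) + E (w + y) := by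
  obtain ⟨φ, hφy, hφx, -⟩ := exists_continuous_zero_one_of_isClosed
    (isClosed_tsupport y) (isClosed_tsupport x) (disjoint_iff_inter_eq_empty.2 hxy).symm
  have hx0 : ∀ t, φ t ≠ 1 → x t = 0 := fun t ht =>
    by_contra fun h => ht (hφx (subset_tsupport _ h))
  have hy0 : ∀ t, φ t ≠ 0 → y t = 0 := fun t ht =>
    by_contra fun h => ht (hφy (subset_tsupport _ h))
  let v : C(X, ℂ) := ⟨fun t => w t * (φ t : ℂ), by fun_prop⟩
  let g : ℂ → ℂ := fun s =>
    E (w - s • v + x + y) + E (w - s • v) - E (w - s • v + x) - E (w - s • v + y)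
  have hl : ∀ u : C(X, ℂ), AnalyticOnNhd ℂ (fun s : ℂ => E (w - s • v + u)) univ := fun u s _ =>
    (hE _).comp_of_eq (f := fun s : ℂ => w - s • v + u)
      ((analyticAt_const.sub (analyticAt_id.smul analyticAt_const)).add analyticAt_const) rfl
  have hg : AnalyticOnNhd ℂ g univ := by
    have h := (((hl (x + y)).add (hl 0)).sub (hl x)).sub (hl y)
    convert h using 1
    ext s
    simp [g, add_assoc]
  have hreal : ∀ s : ℝ, 1 < s → g s = 0 := by
    intro s hs
    let p : C(X, ℂ) := ⟨fun t => w t * (max 0 (1 - s * φ t) : ℝ), by fun_prop⟩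
    let q : C(X, ℂ) := ⟨fun t => w t * (min 0 (1 - s * φ t) : ℝ), by fun_prop⟩
    have hw : w - (s : ℂ) • v = q + p := by
      ext t
      have h : ((min 0 (1 - s * φ t) : ℝ) : ℂ) + (max 0 (1 - s * φ t) : ℝ) = 1 - s * φ t := by
        rw [← Complex.ofReal_add, min_add_max]; simp
      simp only [v, p, q, ContinuousMap.sub_apply, ContinuousMap.smul_apply,
        ContinuousMap.add_apply, ContinuousMap.coe_mk, smul_eq_mul, ← mul_add, h]
      ring
    have hq : ∀ t, s * φ t ≤ 1 → q t = 0 ∧ x t = 0 := fun t ht =>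
      ⟨by simp [q, min_eq_left (sub_nonneg.2 ht)], hx0 t fun h => by rw [h] at ht; linarith⟩
    have hp : ∀ t, 1 ≤ s * φ t → p t = 0 ∧ y t = 0 := fun t ht =>
      ⟨by simp [p, max_eq_left (sub_nonpos.2 ht)], hy0 t fun h => by rw [h] at ht; linarith⟩
    have hmul : ∀ a b : C(X, ℂ), (∀ t, q t = 0 → x t = 0 → a t = 0) →
        (∀ t, p t = 0 → y t = 0 → b t = 0) → E (a + b) = E a + E b := by
      intro a b ha hb
      refine hadd a b ?_
      ext t
      rcases le_total (s * φ t) 1 with h | h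
      · simp [ha t (hq t h).1 (hq t h).2]
      · simp [hb t (hp t h).1 (hp t h).2]
    have h1 := hmul (q + x) (p + y) (by simp +contextual) (by simp +contextual)
    have h2 := hmul q p (by simp +contextual) (by simp +contextual)
    have h3 := hmul (q + x) p (by simp +contextual) (by simp +contextual)
    have h4 := hmul q (p + y) (by simp +contextual) (by simp +contextual)
    simp only [g, hw]
    rw [show q + p + x + y = q + x + (p + y) by abel, show q + p + x = q + x + p by abel,
      show q + p + y = q + (p + y) by abel, h1, h2, h3, h4]
    ring
  have hfreq : ∃ᶠ s in 𝓝[≠] (2 : ℂ), g s = 0 := by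
    have ht : Tendsto (fun s : ℝ => (s : ℂ)) (𝓝[≠] 2) (𝓝[≠] (2 : ℂ)) := by
      refine tendsto_nhdsWithin_iff.2 ⟨?_, ?_⟩
      · simpa using (Complex.continuous_ofReal.tendsto 2).mono_left nhdsWithin_le_nhds
      · filter_upwards [self_mem_nhdsWithin] with s hs
        exact fun h => hs (Complex.ofReal_injective (by simpa using h))
    refine ht.frequently (Eventually.frequently ?_)
    filter_upwards [nhdsWithin_le_nhds (lt_mem_nhds (one_lt_two : (1 : ℝ) < 2))] with s hs
    exact hreal s hs
  have h0 : g 0 = 0 := hg.eqOn_zero_of_preconnected_of_frequently_eq_zero isPreconnected_univ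
    (mem_univ _) hfreq (mem_univ 0)
  simp only [g, zero_smul, sub_zero] at h0
  linear_combination h0

theorem map_add_add_of_mul_eq_zero (hE : ∀ x, AnalyticAt ℂ E x)
    (hadd : ∀ x y : C(X, ℂ), tsupport x ∩ tsupport y = ∅ → E (x + y) = E x + E y)
    {x y : C(X, ℂ)} (hxy : x * y = 0) (w : C(X, ℂ)) :
    E (w + x + y) + E w = E (w + x) + E (w + y) := by
  have hc : Continuous E := continuous_iff_continuousAt.2 fun x => (hE x).continuousAt
  exact closure_minimal
    (t := {p : C(X, ℂ) × C(X, ℂ) | E (w + p.1 + p.2) + E w = E (w + p.1) + E (w + p.2)})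
    (fun p hp => map_add_add_of_tsupport_inter_eq_empty hE
      (fun _ _ h => map_add_of_mul_eq_zero hc hadd h) hp w)
    (isClosed_eq (by fun_prop) (by fun_prop))
    (mem_closure_tsupport_inter_eq_empty hxy)

end OrthogonallyAdditive

section LocallyAdditive

variable {A : Type*} [CommRing A] {E : A → ℂ}

theorem map_add_add_of_add_eq (h0 : E 0 = 0)
    (hloc : ∀ x y w : A, x * y = 0 → E (w + x + y) + E w = E (w + x) + E (w + y))
    {u v a b : A} (hau : a * u = 0) (hbv : b * v = 0) :
    E (u + v + (a + b)) = E (u + v) + E (u + (a + b)) + E (v + (a + b))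
      - E u - E v - E (a + b) := by
  have h1 := hloc a u (v + b) hau
  have h2 := hloc b v u hbv
  have h3 := hloc b v 0 hbv
  have h4 := hloc a u b hau
  rw [show v + b + a + u = u + v + (a + b) by ring, show v + b + a = v + (a + b) by ring,
    show v + b + u = u + b + v by ring, show v + b = b + v by ring] at h1
  rw [show b + a + u = u + (a + b) by ring, show b + a = a + b by ring, add_comm b u] at h4
  simp only [zero_add, h0] at h3
  linear_combination h1 + h2 - h3 - h4

theorem map_sum_range_of_mul_eq_zero
    (hloc : ∀ x y w : A, x * y = 0 → E (w + x + y) + E w = E (w + x) + E (w + y))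
    (Z : ℕ → A) (m : ℕ) (hZ : ∀ i k, i + 1 < k → k ≤ m + 1 → Z i * Z k = 0) :
    E (∑ j ∈ Finset.range (m + 2), Z j) =
      ∑ j ∈ Finset.range (m + 1), E (Z j + Z (j + 1)) - ∑ j ∈ Finset.range m, E (Z (j + 1)) := by
  induction m with
  | zero => simp [Finset.sum_range_succ]
  | succ m ih =>
    have h := hloc (∑ j ∈ Finset.range (m + 1), Z j) (Z (m + 2)) (Z (m + 1)) (by
      rw [Finset.sum_mul]
      exact Finset.sum_eq_zero fun i hi =>
        hZ i _ (by have := Finset.mem_range.1 hi; omega) (by omega))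
    have ih := ih fun i k hik hk => hZ i k hik (by omega)
    rw [add_comm (Z (m + 1)), ← Finset.sum_range_succ, ← Finset.sum_range_succ, ih] at h
    rw [Finset.sum_range_succ (fun j => E (Z j + Z (j + 1))),
      Finset.sum_range_succ (fun j => E (Z (j + 1))) m]
    linear_combination h

/-- The cyclic formula for a sequence `Z 0, …, Z (m + 2)`. -/
theorem map_sum_range_of_cyclic (h0 : E 0 = 0)
    (hloc : ∀ x y w : A, x * y = 0 → E (w + x + y) + E w = E (w + x) + E (w + y))
    (Z : ℕ → A) (m : ℕ) (hZ : ∀ i k, i + 1 < k → k ≤ m + 1 → Z i * Z k = 0)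
    (hlast : ∀ i < m, Z (i + 1) * Z (m + 2) = 0)
    (hsplit : ∃ a b, a + b = Z (m + 2) ∧ a * Z 0 = 0 ∧ b * Z (m + 1) = 0) :
    E (∑ j ∈ Finset.range (m + 3), Z j) =
      (∑ j ∈ Finset.range (m + 2), E (Z j + Z (j + 1)) + E (Z (m + 2) + Z 0))
        - ∑ j ∈ Finset.range (m + 3), E (Z j) := by
  have hchain := map_sum_range_of_mul_eq_zero hloc Z m hZ
  obtain ⟨a, b, hab, hau, hbv⟩ := hsplit
  have htri := map_add_add_of_add_eq h0 hloc hau hbv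
  rw [hab, add_comm (Z 0) (Z (m + 2))] at htri
  have h := hloc (∑ j ∈ Finset.range m, Z (j + 1)) (Z (m + 2)) (Z 0 + Z (m + 1)) (by
    rw [Finset.sum_mul]
    exact Finset.sum_eq_zero fun i hi => hlast i (Finset.mem_range.1 hi))
  have hsum : Z 0 + Z (m + 1) + ∑ j ∈ Finset.range m, Z (j + 1)
      = ∑ j ∈ Finset.range (m + 2), Z j := by
    rw [Finset.sum_range_succ, Finset.sum_range_succ']
    ring
  rw [hsum, ← Finset.sum_range_succ, hchain, htri] at h
  rw [Finset.sum_range_succ (fun j => E (Z j + Z (j + 1))) (m + 1),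
    Finset.sum_range_succ (fun j => E (Z j)) (m + 2),
    Finset.sum_range_succ (fun j => E (Z j)) (m + 1), Finset.sum_range_succ' (fun j => E (Z j)) m]
  linear_combination h

end LocallyAdditive

theorem ZMod.sum_eq_sum_range {M : Type*} [AddCommMonoid M] (N : ℕ) [NeZero N] (f : ZMod N → M) :
    ∑ j, f j = ∑ i ∈ Finset.range N, f i := by
  symm
  refine Finset.sum_bij' (fun i _ => (i : ZMod N)) (fun j _ => j.val) ?_ ?_ ?_ ?_ ?_
  · simp
  · intro j _
    exact Finset.mem_range.2 j.val_lt
  · intro i hi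
    exact ZMod.val_cast_of_lt (Finset.mem_range.1 hi)
  · simp
  · simp

/-- The second formula of Lemma 5.2: if `E` is an additive analytic function on
`C(S¹, ℂ)`, `N ≥ 3`, no point of `S¹` lies in the support of more than two of the
`z_j` (indexed cyclically by `ZMod N`), and non-consecutive `z_j` have disjoint
supports, then `E(Σ z_j) = Σ_j E(z_{j−1} + z_j) − Σ_j E(z_j)`. (The `NeZero N`
instance follows from `3 ≤ N`.) -/
theorem additive_analytic_cyclic_sum_formula
    (E : C(AddCircle (1 : ℝ), ℂ) → ℂ)
    (hE : ∀ x, AnalyticAt ℂ E x)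
    (hadd : ∀ x y : C(AddCircle (1 : ℝ), ℂ),
      tsupport ⇑x ∩ tsupport ⇑y = ∅ → E (x + y) = E x + E y)
    (N : ℕ) (hN : 3 ≤ N) [NeZero N]
    (z : ZMod N → C(AddCircle (1 : ℝ), ℂ))
    (htwo : ∀ i j k : ZMod N, i ≠ j → j ≠ k → i ≠ k →
      tsupport ⇑(z i) ∩ tsupport ⇑(z j) ∩ tsupport ⇑(z k) = ∅)
    (hconsec : ∀ i j : ZMod N, i ≠ j → i ≠ j + 1 → j ≠ i + 1 →
      tsupport ⇑(z i) ∩ tsupport ⇑(z j) = ∅) :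
    E (∑ j, z j) = (∑ j, E (z (j - 1) + z j)) - ∑ j, E (z j) := by
  obtain ⟨m, rfl⟩ : ∃ m, N = m + 3 := ⟨N - 3, by omega⟩
  have h0 : E 0 = 0 := by
    have h := map_add_of_mul_eq_zero
      (continuous_iff_continuousAt.2 fun x => (hE x).continuousAt) hadd (mul_zero 0)
    simpa using h
  have hne : ∀ i j : ℕ, i < m + 3 → j < m + 3 → i ≠ j → (i : ZMod (m + 3)) ≠ j := by
    intro i j hi hj hij h
    rw [ZMod.natCast_eq_natCast_iff'] at h
    rw [Nat.mod_eq_of_lt hi, Nat.mod_eq_of_lt hj] at h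
    exact hij h
  have hlast : ((m + 2 : ℕ) : ZMod (m + 3)) + 1 = (0 : ℕ) := by
    have h := ZMod.natCast_self (m + 3)
    push_cast at h ⊢
    linear_combination h
  have hmul : ∀ i k : ℕ, i + 1 < k → k < m + 3 → (k = m + 2 → i ≠ 0) →
      z i * z k = 0 := by
    intro i k hik hk hi0
    refine mul_eq_zero_of_tsupport_inter_eq_empty (hconsec _ _ ?_ ?_ ?_)
    · exact hne i k (by omega) hk (by omega)
    · rcases eq_or_ne k (m + 2) with rfl | hk2
      · rw [hlast]
        exact hne i 0 (by omega) (by omega) (hi0 rfl)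
      · exact_mod_cast hne i (k + 1) (by omega) (by omega) (by omega)
    · exact_mod_cast hne k (i + 1) hk (by omega) (by omega)
  have key := map_sum_range_of_cyclic h0
    (fun x y w h => map_add_add_of_mul_eq_zero hE hadd h w) (fun i : ℕ => z i) m
    (fun i k hik hk => hmul i k hik (by omega) (by omega))
    (fun i hi => hmul (i + 1) (m + 2) (by omega) (by omega) (by omega))
    (exists_add_eq_mul_eq_zero (htwo _ _ _
      (hne 0 (m + 1) (by omega) (by omega) (by omega))
      (hne (m + 1) (m + 2) (by omega) (by omega) (by omega))
      (hne 0 (m + 2) (by omega) (by omega) (by omega))))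
  have hshift : ∑ j, E (z (j - 1) + z j) = ∑ j, E (z j + z (j + 1)) :=
    Fintype.sum_equiv (Equiv.subRight 1) _ _ fun j => by simp
  rw [hshift, ZMod.sum_eq_sum_range, ZMod.sum_eq_sum_range, ZMod.sum_eq_sum_range, key,
    Finset.sum_range_succ (fun j : ℕ => E (z j + z (j + 1))) (m + 2), hlast]
  simp only [Nat.cast_add, Nat.cast_one]
end

section
/- Let a < t₀ < b be real numbers and let g : ℝ → ℂ be a measurable function with ∫_a^b |g(s)|³ ds < ∞. Define z(t) = ∫_{t₀}^t g(s) ds. Then the function t ↦ ‖z(t)‖^{−3/2} is not Lebesgue integrable on (a, b); more precisely, the lower Lebesgue integral ∫⁻_{(a,b)} (‖z(t)‖ₑ)^{(−3/2 : ℝ)} dt equals ∞ in [0,∞] (with the convention that in the extended nonnegative reals 0 raised to a negative power is ∞). -/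
open MeasureTheory

/-- Hölder's inequality against the constant function `1`, with exponents `3` and `3 / 2`. -/
theorem lintegral_le_rpow_lintegral_cube_mul_rpow_measure {α : Type*} [MeasurableSpace α]
    (μ : Measure α) {f : α → ENNReal} (hf : AEMeasurable f μ) :
    ∫⁻ x, f x ∂μ ≤ (∫⁻ x, f x ^ (3 : ℕ) ∂μ) ^ (1 / 3 : ℝ) * μ Set.univ ^ (2 / 3 : ℝ) := by
  have hpq : (3 : ℝ).HolderConjugate (3 / 2) := by
    rw [Real.holderConjugate_iff]
    norm_num
  have h := ENNReal.lintegral_mul_le_Lp_mul_Lq μ hpq hf (aemeasurable_const (b := 1))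
  have hcube (x : ENNReal) : x ^ (3 : ℝ) = x ^ (3 : ℕ) := by
    exact_mod_cast ENNReal.rpow_natCast x 3
  simpa [hcube] using h

/-- The function `t ↦ (t - c)⁻¹` has infinite integral to the right of `c`. -/
theorem lintegral_Ioo_ofReal_sub_inv_eq_top {c b : ℝ} (hcb : c < b) :
    ∫⁻ t in Set.Ioo c b, (ENNReal.ofReal (t - c))⁻¹ = ⊤ := by
  by_contra hfin
  have hint : IntervalIntegrable (fun t : ℝ ↦ (t - c)⁻¹) volume c b := by
    rw [intervalIntegrable_iff_integrableOn_Ioo_of_le hcb.le]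
    refine ⟨by fun_prop, ?_⟩
    rw [hasFiniteIntegral_iff_enorm]
    refine lt_of_eq_of_lt (setLIntegral_congr_fun measurableSet_Ioo fun t ht ↦ ?_)
      (lt_top_iff_ne_top.2 hfin)
    have hpos : 0 < t - c := sub_pos.2 ht.1
    simp only [Real.enorm_of_nonneg (inv_nonneg.2 hpos.le), ENNReal.ofReal_inv_of_pos hpos]
  rcases intervalIntegrable_sub_inv_iff.1 hint with h | h
  · exact hcb.ne h
  · exact h Set.left_mem_uIcc

/-- The key analytic claim in the proof of Lemma 3.4: if `g` is measurable with
`∫_a^b |g|³ < ∞` and `z(t) = ∫_{t₀}^t g`, where `a < t₀ < b`, then `‖z‖^{−3/2}` is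
not integrable on `(a,b)`: its lower Lebesgue integral is infinite (with the
convention that in `ℝ≥0∞` zero raised to a negative power is `∞`). -/
theorem lintegral_rpow_neg_of_W13_vanishing
    (a t₀ b : ℝ) (ha : a < t₀) (hb : t₀ < b)
    (g : ℝ → ℂ) (hg : Measurable g)
    (hg3 : ∫⁻ s in Set.Ioo a b, (‖g s‖₊ : ENNReal) ^ (3 : ℕ) < ⊤) :
    ∫⁻ t in Set.Ioo a b,
        ((‖∫ s in t₀..t, g s‖₊ : ENNReal) ^ (-(3 / 2) : ℝ)) = ⊤ := by
  set K := ∫⁻ s in Set.Ioo a b, (‖g s‖₊ : ENNReal) ^ (3 : ℕ)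
  have hbound : ∀ t ∈ Set.Ioo t₀ b,
      (‖∫ s in t₀..t, g s‖₊ : ENNReal) ≤
        K ^ (1 / 3 : ℝ) * ENNReal.ofReal (t - t₀) ^ (2 / 3 : ℝ) := by
    intro t ht
    rw [intervalIntegral.integral_of_le ht.1.le]
    calc (‖∫ s in Set.Ioc t₀ t, g s‖₊ : ENNReal)
        ≤ ∫⁻ s in Set.Ioc t₀ t, (‖g s‖₊ : ENNReal) := enorm_integral_le_lintegral_enorm _
      _ ≤ _ := lintegral_le_rpow_lintegral_cube_mul_rpow_measure _
          hg.nnnorm.coe_nnreal_ennreal.aemeasurable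
      _ ≤ K ^ (1 / 3 : ℝ) * ENNReal.ofReal (t - t₀) ^ (2 / 3 : ℝ) := by
          rw [Measure.restrict_apply_univ, Real.volume_Ioc]
          gcongr
          exact lintegral_mono_set fun s hs ↦ ⟨ha.trans hs.1, hs.2.trans_lt ht.2⟩
  rw [eq_top_iff]
  calc (⊤ : ENNReal)
      = K ^ (-(1 / 2) : ℝ) * ∫⁻ t in Set.Ioo t₀ b, (ENNReal.ofReal (t - t₀))⁻¹ := by
        rw [lintegral_Ioo_ofReal_sub_inv_eq_top hb, ENNReal.mul_top]
        simp [ENNReal.rpow_eq_zero_iff, hg3.ne]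
    _ = ∫⁻ t in Set.Ioo t₀ b, K ^ (-(1 / 2) : ℝ) * (ENNReal.ofReal (t - t₀))⁻¹ :=
        (lintegral_const_mul _ (by fun_prop)).symm
    _ ≤ ∫⁻ t in Set.Ioo t₀ b, (‖∫ s in t₀..t, g s‖₊ : ENNReal) ^ (-(3 / 2) : ℝ) := by
        refine setLIntegral_mono' measurableSet_Ioo fun t ht ↦ ?_
        have hrpow : (K ^ (1 / 3 : ℝ) * ENNReal.ofReal (t - t₀) ^ (2 / 3 : ℝ)) ^ (-(3 / 2) : ℝ) =
            K ^ (-(1 / 2) : ℝ) * (ENNReal.ofReal (t - t₀))⁻¹ := by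
          rw [ENNReal.mul_rpow_of_ne_top
              (ENNReal.rpow_ne_top_of_nonneg (by norm_num) hg3.ne)
              (ENNReal.rpow_ne_top_of_nonneg (by norm_num) ENNReal.ofReal_ne_top),
            ← ENNReal.rpow_mul, ← ENNReal.rpow_mul, ← ENNReal.rpow_neg_one]
          norm_num
        rw [← hrpow]
        simp only [ENNReal.rpow_neg _ (3 / 2 : ℝ)]
        exact ENNReal.inv_le_inv.2 (ENNReal.rpow_le_rpow (hbound t ht) (by norm_num))
    _ ≤ _ := lintegral_mono_set (Set.Ioo_subset_Ioo_left ha.le)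
end

section
/- For all real numbers a > 0 and b > 0, the improper Lebesgue integral over the real line satisfies ∫_ℝ dt / ((it − a)² (it + b)²) = 4π / (a + b)³, where i is the imaginary unit and the integrand is a complex-valued function of t ∈ ℝ. -/
open MeasureTheory

open Filter Topology

theorem Complex.I_mul_ofReal_add_ofReal_ne_zero {c : ℝ} (hc : c ≠ 0) (t : ℝ) :
    Complex.I * t + c ≠ 0 := fun h => hc (by simpa using congrArg Complex.re h)

theorem Complex.norm_I_mul_ofReal_add_ofReal_sq (c t : ℝ) :
    ‖Complex.I * t + c‖ ^ 2 = c ^ 2 + t ^ 2 := by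
  rw [Complex.sq_norm, Complex.normSq_apply]
  simp
  ring

theorem hasDerivAt_I_mul_inv_I_mul_add {c : ℝ} (hc : c ≠ 0) (t : ℝ) :
    HasDerivAt (fun t : ℝ => Complex.I * (Complex.I * t + c)⁻¹)
      (1 / (Complex.I * t + c) ^ 2) t := by
  have h0 := Complex.I_mul_ofReal_add_ofReal_ne_zero hc t
  have h1 : HasDerivAt (fun t : ℝ => Complex.I * (t : ℂ) + c) (Complex.I * 1) t :=
    (Complex.ofRealCLM.hasDerivAt.const_mul Complex.I).add_const _
  refine ((h1.inv h0).const_mul Complex.I).congr_deriv ?_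
  field_simp
  simp

/-- `arctan (t / c) - (i / 2) log (c ^ 2 + t ^ 2)` is an antiderivative of `1 / (i t + c)`. -/
theorem hasDerivAt_arctan_sub_I_mul_log {c : ℝ} (hc : c ≠ 0) (t : ℝ) :
    HasDerivAt (fun t : ℝ => ((Real.arctan (t / c) : ℝ) : ℂ) -
      Complex.I / 2 * ((Real.log (c ^ 2 + t ^ 2) : ℝ) : ℂ)) (1 / (Complex.I * t + c)) t := by
  have h0 := Complex.I_mul_ofReal_add_ofReal_ne_zero hc t
  have hp : c ^ 2 + t ^ 2 ≠ 0 := by positivity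
  have hpc : (c : ℂ) ^ 2 + (t : ℂ) ^ 2 ≠ 0 := by exact_mod_cast hp
  have h1 : HasDerivAt (fun t : ℝ => Real.arctan (t / c)) (c / (c ^ 2 + t ^ 2)) t := by
    refine ((hasDerivAt_id t).div_const c).arctan.congr_deriv ?_
    simp only [id]
    field_simp
  have h2 : HasDerivAt (fun t : ℝ => Real.log (c ^ 2 + t ^ 2)) (2 * t / (c ^ 2 + t ^ 2)) t := by
    refine (((hasDerivAt_pow 2 t).const_add (c ^ 2)).log hp).congr_deriv ?_
    simp
  refine (h1.ofReal_comp.sub (h2.ofReal_comp.const_mul (Complex.I / 2))).congr_deriv ?_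
  push_cast
  rw [eq_div_iff h0]
  field_simp
  linear_combination -(t : ℂ) ^ 2 * Complex.I_sq

theorem tendsto_inv_I_mul_add {l : Filter ℝ} (hl : Tendsto (fun t : ℝ => t ^ 2) l atTop) (c : ℝ) :
    Tendsto (fun t : ℝ => (Complex.I * t + c)⁻¹) l (𝓝 0) := by
  rw [tendsto_zero_iff_norm_tendsto_zero]
  have h := (Real.continuous_sqrt.tendsto 0).comp
    (tendsto_inv_atTop_zero.comp (tendsto_atTop_add_const_left l (c ^ 2) hl))
  rw [Real.sqrt_zero] at h
  refine h.congr fun t => ?_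
  simp only [Function.comp]
  rw [← Complex.norm_I_mul_ofReal_add_ofReal_sq, Real.sqrt_inv, Real.sqrt_sq (norm_nonneg _),
    norm_inv]

theorem tendsto_log_sq_add_sub_log_sq_add {l : Filter ℝ}
    (hl : Tendsto (fun t : ℝ => t ^ 2) l atTop) {a b : ℝ} (ha : a ≠ 0) (hb : b ≠ 0) :
    Tendsto (fun t : ℝ => Real.log (a ^ 2 + t ^ 2) - Real.log (b ^ 2 + t ^ 2)) l (𝓝 0) := by
  have h : Tendsto (fun t : ℝ => 1 + (a ^ 2 - b ^ 2) * (b ^ 2 + t ^ 2)⁻¹) l (𝓝 1) := by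
    simpa using ((tendsto_inv_atTop_zero.comp
      (tendsto_atTop_add_const_left l (b ^ 2) hl)).const_mul (a ^ 2 - b ^ 2)).const_add 1
  have h2 := h.log one_ne_zero
  rw [Real.log_one] at h2
  refine h2.congr fun t => ?_
  have hp : a ^ 2 + t ^ 2 ≠ 0 := by positivity
  have hq : b ^ 2 + t ^ 2 ≠ 0 := by positivity
  rw [← Real.log_div hp hq]
  congr 1
  field_simp
  ring

theorem integrable_kernel {a b : ℝ} (ha : a ≠ 0) (hb : b ≠ 0) :
    Integrable fun t : ℝ =>
      (1 : ℂ) / ((Complex.I * t + a) ^ 2 * (Complex.I * t + b) ^ 2) := by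
  have hi := (integrable_inv_one_add_sq.comp_div ha).const_mul ((a ^ 2 * b ^ 2)⁻¹)
  refine hi.mono' ?_ (Eventually.of_forall fun t => ?_)
  · refine (Continuous.div continuous_const (by fun_prop) fun t => ?_).aestronglyMeasurable
    exact mul_ne_zero (pow_ne_zero _ (Complex.I_mul_ofReal_add_ofReal_ne_zero ha t))
      (pow_ne_zero _ (Complex.I_mul_ofReal_add_ofReal_ne_zero hb t))
  · rw [norm_div, norm_mul, norm_pow, norm_pow, norm_one,
      Complex.norm_I_mul_ofReal_add_ofReal_sq, Complex.norm_I_mul_ofReal_add_ofReal_sq,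
      ← mul_inv, one_div]
    have h : a ^ 2 * b ^ 2 * (1 + (t / a) ^ 2) = (a ^ 2 + t ^ 2) * b ^ 2 := by
      field_simp
    rw [h]
    gcongr
    exact le_add_of_nonneg_right (sq_nonneg t)

/-- An antiderivative of `1 / ((i t - a) ^ 2 * (i t + b) ^ 2)`, from partial fractions. -/
noncomputable def kernelPrimitive (a b t : ℝ) : ℂ :=
  1 / ((a : ℂ) + b) ^ 2 *
      (Complex.I * (Complex.I * t + (-a : ℝ))⁻¹ + Complex.I * (Complex.I * t + b)⁻¹) -
    2 / ((a : ℂ) + b) ^ 3 *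
      ((((Real.arctan (t / (-a)) : ℝ) : ℂ) -
          Complex.I / 2 * ((Real.log ((-a) ^ 2 + t ^ 2) : ℝ) : ℂ)) -
        (((Real.arctan (t / b) : ℝ) : ℂ) -
          Complex.I / 2 * ((Real.log (b ^ 2 + t ^ 2) : ℝ) : ℂ)))

theorem hasDerivAt_kernelPrimitive {a b : ℝ} (ha : 0 < a) (hb : 0 < b) (t : ℝ) :
    HasDerivAt (kernelPrimitive a b)
      (1 / ((Complex.I * t + (-a : ℝ)) ^ 2 * (Complex.I * t + b) ^ 2)) t := by
  have hna : -a ≠ 0 := (neg_neg_of_pos ha).ne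
  have hp := Complex.I_mul_ofReal_add_ofReal_ne_zero hna t
  have hq := Complex.I_mul_ofReal_add_ofReal_ne_zero hb.ne' t
  have hs : (a : ℂ) + b ≠ 0 := by exact_mod_cast (add_pos ha hb).ne'
  refine ((((hasDerivAt_I_mul_inv_I_mul_add hna t).add
    (hasDerivAt_I_mul_inv_I_mul_add hb.ne' t)).const_mul _).sub
    (((hasDerivAt_arctan_sub_I_mul_log hna t).sub
      (hasDerivAt_arctan_sub_I_mul_log hb.ne' t)).const_mul _)).congr_deriv ?_
  have hsum : (a : ℂ) + b = (Complex.I * t + b) - (Complex.I * t + (-a : ℝ)) := by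
    push_cast
    ring
  rw [hsum] at hs ⊢
  generalize Complex.I * (t : ℂ) + b = q at *
  generalize Complex.I * (t : ℂ) + (-a : ℝ) = p at *
  field_simp
  ring

theorem tendsto_kernelPrimitive {a b : ℝ} (ha : 0 < a) (hb : 0 < b) {l : Filter ℝ}
    (hl : Tendsto (fun t : ℝ => t ^ 2) l atTop) {x : ℝ}
    (hx : ∀ c : ℝ, 0 < c → Tendsto (fun t : ℝ => Real.arctan (t / c)) l (𝓝 x)) :
    Tendsto (kernelPrimitive a b) l (𝓝 (4 * x / ((a : ℂ) + b) ^ 3)) := by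
  have hlog := (Complex.continuous_ofReal.tendsto 0).comp
    (tendsto_log_sq_add_sub_log_sq_add hl ha.ne' hb.ne')
  have hA := (Complex.continuous_ofReal.tendsto x).comp (hx a ha)
  have hB := (Complex.continuous_ofReal.tendsto x).comp (hx b hb)
  have h := ((((tendsto_inv_I_mul_add hl (-a)).const_mul Complex.I).add
    ((tendsto_inv_I_mul_add hl b).const_mul Complex.I)).const_mul (1 / ((a : ℂ) + b) ^ 2)).add
    (((hA.add hB).add (hlog.const_mul (Complex.I / 2))).const_mul (2 / ((a : ℂ) + b) ^ 3))
  convert h using 1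
  · funext t
    simp only [kernelPrimitive, Function.comp, div_neg, Real.arctan_neg, neg_sq]
    push_cast
    ring
  · congr 1
    push_cast
    ring

/-- The kernel computation (4.14) in the proof of Lemma 4.4: for `a, b > 0`,
`∫_ℝ dt / ((it − a)² (it + b)²) = 4π / (a + b)³`. -/
theorem integral_kernel_eval
    (a b : ℝ) (ha : 0 < a) (hb : 0 < b) :
    ∫ t : ℝ, (1 : ℂ) / ((Complex.I * t - a) ^ 2 * (Complex.I * t + b) ^ 2) =
      ((4 * Real.pi / (a + b) ^ 3 : ℝ) : ℂ) := by
  have hbot := tendsto_kernelPrimitive ha hb (l := atBot) (x := -(Real.pi / 2))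
    (by simpa only [sq, id] using tendsto_id.atBot_mul_atBot₀ tendsto_id) fun c hc =>
      (tendsto_nhds_of_tendsto_nhdsWithin Real.tendsto_arctan_atBot).comp
        (tendsto_id.atBot_div_const hc)
  have htop := tendsto_kernelPrimitive ha hb (l := atTop) (x := Real.pi / 2)
    (tendsto_pow_atTop two_ne_zero) fun c hc =>
      (tendsto_nhds_of_tendsto_nhdsWithin Real.tendsto_arctan_atTop).comp
        (tendsto_id.atTop_div_const hc)
  have h := integral_of_hasDerivAt_of_tendsto (hasDerivAt_kernelPrimitive ha hb)
    (integrable_kernel (neg_neg_of_pos ha).ne hb.ne') hbot htop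
  simp only [Complex.ofReal_neg, ← sub_eq_add_neg] at h
  rw [h]
  push_cast
  ring
end

section
/- For all natural numbers α and β there exist a natural number n and complex constants c_{j,h} for 0 ≤ j, h ≤ n such that for every infinitely differentiable function x : ℝ → ℂ one has the identity x^{(α)}(t) · x^{(β)}(t) = Σ_{j=0}^{n} Σ_{h=0}^{n} c_{j,h} · (d/dt)^{h} ( x^{(j)}(t)² ) for all t ∈ ℝ, where x^{(d)} denotes the d-th iterated derivative of x. -/
/-- The `h`-th derivative of the square of the `j`-th derivative, for `p = (j, h)`, as a function
of a smooth function and a point. -/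
noncomputable def iteratedDerivSq (p : ℕ × ℕ) (x : {x : ℝ → ℂ // ContDiff ℝ (⊤ : ℕ∞) x}) :
    ℝ → ℂ :=
  iteratedDeriv p.2 fun s => iteratedDeriv p.1 x.1 s ^ 2

theorem contDiff_iteratedDeriv_of_contDiff_top {x : ℝ → ℂ} (hx : ContDiff ℝ (⊤ : ℕ∞) x) (n : ℕ) :
    ContDiff ℝ (⊤ : ℕ∞) (iteratedDeriv n x) := by
  rw [iteratedDeriv_eq_iterate]
  exact hx.iterate_deriv n

theorem differentiable_iteratedDeriv_of_contDiff_top {x : ℝ → ℂ} (hx : ContDiff ℝ (⊤ : ℕ∞) x)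
    (n : ℕ) : Differentiable ℝ (iteratedDeriv n x) :=
  (contDiff_iteratedDeriv_of_contDiff_top hx n).differentiable (by simp)

theorem deriv_mem_span_iteratedDerivSq {F : {x : ℝ → ℂ // ContDiff ℝ (⊤ : ℕ∞) x} → ℝ → ℂ}
    (hF : F ∈ Submodule.span ℂ (Set.range iteratedDerivSq)) :
    (fun x => deriv (F x)) ∈ Submodule.span ℂ (Set.range iteratedDerivSq) := by
  suffices h : (∀ x, Differentiable ℝ (F x)) ∧
      (fun x => deriv (F x)) ∈ Submodule.span ℂ (Set.range iteratedDerivSq) from h.2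
  induction hF using Submodule.span_induction with
  | mem F hF =>
    obtain ⟨⟨j, h⟩, rfl⟩ := hF
    refine ⟨fun x => differentiable_iteratedDeriv_of_contDiff_top
      ((contDiff_iteratedDeriv_of_contDiff_top x.2 j).pow 2) h, ?_⟩
    refine Submodule.subset_span ⟨(j, h + 1), ?_⟩
    funext x
    exact iteratedDeriv_succ
  | zero =>
    refine ⟨fun x => differentiable_const 0, ?_⟩
    convert Submodule.zero_mem _ using 1
    funext x t
    exact deriv_const t 0
  | add F G _ _ hF hG =>
    refine ⟨fun x => (hF.1 x).add (hG.1 x), ?_⟩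
    convert Submodule.add_mem _ hF.2 hG.2 using 1
    funext x t
    exact deriv_add (hF.1 x t) (hG.1 x t)
  | smul a F _ hF =>
    refine ⟨fun x => (hF.1 x).const_smul a, ?_⟩
    convert Submodule.smul_mem _ a hF.2 using 1
    funext x t
    exact deriv_const_smul a (hF.1 x t)

theorem deriv_iteratedDeriv_mul_iteratedDeriv {x : ℝ → ℂ} (hx : ContDiff ℝ (⊤ : ℕ∞) x)
    (α β : ℕ) (t : ℝ) :
    deriv (fun s => iteratedDeriv α x s * iteratedDeriv β x s) t =
      iteratedDeriv (α + 1) x t * iteratedDeriv β x t +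
        iteratedDeriv α x t * iteratedDeriv (β + 1) x t := by
  rw [iteratedDeriv_succ, iteratedDeriv_succ]
  exact deriv_mul (differentiable_iteratedDeriv_of_contDiff_top hx α t)
    (differentiable_iteratedDeriv_of_contDiff_top hx β t)

theorem iteratedDeriv_mul_iteratedDeriv_add_mem_span (α d : ℕ) :
    (fun (x : {x : ℝ → ℂ // ContDiff ℝ (⊤ : ℕ∞) x}) t =>
      iteratedDeriv α x.1 t * iteratedDeriv (α + d) x.1 t) ∈
      Submodule.span ℂ (Set.range iteratedDerivSq) := by
  induction d using Nat.twoStepInduction generalizing α with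
  | zero =>
    refine Submodule.subset_span ⟨(α, 0), ?_⟩
    funext x t
    simp [iteratedDerivSq, sq]
  | one =>
    have key : iteratedDerivSq (α, 1) ∈ Submodule.span ℂ (Set.range iteratedDerivSq) :=
      Submodule.subset_span ⟨(α, 1), rfl⟩
    convert Submodule.smul_mem _ (1 / 2 : ℂ) key using 1
    funext x t
    simp only [iteratedDerivSq, Pi.smul_apply, smul_eq_mul, iteratedDeriv_one, sq,
      deriv_iteratedDeriv_mul_iteratedDeriv x.2]
    ring
  | more d ih₀ ih₁ =>
    convert Submodule.sub_mem _ (deriv_mem_span_iteratedDerivSq (ih₁ α)) (ih₀ (α + 1)) using 1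
    funext x t
    simp only [Pi.sub_apply, deriv_iteratedDeriv_mul_iteratedDeriv x.2]
    rw [show α + 1 + d = α + (d + 1) by ring, show α + (d + 2) = α + (d + 1) + 1 by ring]
    ring

theorem iteratedDeriv_mul_iteratedDeriv_mem_span (α β : ℕ) :
    (fun (x : {x : ℝ → ℂ // ContDiff ℝ (⊤ : ℕ∞) x}) t =>
      iteratedDeriv α x.1 t * iteratedDeriv β x.1 t) ∈
      Submodule.span ℂ (Set.range iteratedDerivSq) := by
  rcases le_total α β with h | h
  · obtain ⟨d, rfl⟩ := Nat.exists_eq_add_of_le h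
    exact iteratedDeriv_mul_iteratedDeriv_add_mem_span α d
  · obtain ⟨d, rfl⟩ := Nat.exists_eq_add_of_le h
    simpa only [mul_comm] using iteratedDeriv_mul_iteratedDeriv_add_mem_span β d


/-- The algebraic claim in the proof of Lemma 2.4: for all `α, β` there are universal
complex constants `c_{j,h}` (`0 ≤ j, h ≤ n`) such that for every smooth `x : ℝ → ℂ`,
`x^{(α)} x^{(β)} = Σ_{j,h} c_{j,h} (x^{(j)} x^{(j)})^{(h)}`. -/
theorem product_of_derivatives_as_combination_of_derivatives_of_squares
    (α β : ℕ) :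
    ∃ (n : ℕ) (c : ℕ → ℕ → ℂ),
      ∀ x : ℝ → ℂ, ContDiff ℝ (⊤ : ℕ∞) x → ∀ t : ℝ,
        iteratedDeriv α x t * iteratedDeriv β x t =
          ∑ j ∈ Finset.range (n + 1), ∑ h ∈ Finset.range (n + 1),
            c j h * iteratedDeriv h (fun s => (iteratedDeriv j x s) ^ 2) t := by
  obtain ⟨c, hc⟩ := Finsupp.mem_span_range_iff_exists_finsupp.mp
    (iteratedDeriv_mul_iteratedDeriv_mem_span α β)
  refine ⟨c.support.sup fun p => p.1 + p.2, fun j h => c (j, h), fun x hx t => ?_⟩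
  set n := c.support.sup fun p => p.1 + p.2
  have hsub : c.support ⊆ Finset.range (n + 1) ×ˢ Finset.range (n + 1) := fun p hp => by
    have hle : p.1 + p.2 ≤ n := Finset.le_sup (f := fun p : ℕ × ℕ => p.1 + p.2) hp
    simp only [Finset.mem_product, Finset.mem_range]
    omega
  rw [Finsupp.sum_of_support_subset c hsub _ (by simp), Finset.sum_product] at hc
  have hxt := congrFun (congrFun hc ⟨x, hx⟩) t
  simp only [Finset.sum_apply, Pi.smul_apply, smul_eq_mul, iteratedDerivSq] at hxt
  exact hxt.symm
end
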